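/- arXiv:2511.06482 — 8 statements merged into one kernel-verified Lean document; each statement's English description precedes it below -/
import Mathlib

section
/- Let e ≥ 10 be an integer. The defining toric ideal I_{S(e,1,2)} of the numerical semigroup S(e,1,2) inside the polynomial ring R(e,1,2) = K[x_0, x_3, x_4, …, x_{e−1}] is generated by the set G = {x_i x_{j+1} − x_{i+1} x_j : 3 ≤ i < j ≤ e−2} ∪ {x_0^2 x_i − x_{i+1} x_{e−1} : 3 ≤ i ≤ e−2} ∪ {x_0 x_{i+3} − x_3 x_i : 3 ≤ i ≤ e−4} ∪ {x_0^3 − x_3 x_{e−3}}, and moreover G is a minimal generating set of I_{S(e,1,2)} (no proper subset of G generates I_{S(e,1,2)}). -/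
open MvPolynomial

/-- Index set of the polynomial ring `R(e,m,n)`: indices `i ∈ {0,…,e−1} \ {m,n}`. -/
abbrev SallyIdx (e m n : ℕ) : Type := {i : ℕ // i < e ∧ i ≠ m ∧ i ≠ n}

/-- The variable `x_i` of `R(e,m,n)` (and `0` for an invalid index). -/
noncomputable def sX (e m n : ℕ) (i : ℕ) : MvPolynomial (SallyIdx e m n) ℚ :=
  if h : i < e ∧ i ≠ m ∧ i ≠ n then MvPolynomial.X ⟨i, h⟩ else 0

/-- The defining toric ideal `I_{S(e,m,n)}`: the kernel of the `ℚ`-algebra homomorphism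
`R(e,m,n) → ℚ[t]` sending `x_i ↦ t^{e+i}`. -/
noncomputable def sallyIdeal (e m n : ℕ) : Ideal (MvPolynomial (SallyIdx e m n) ℚ) :=
  RingHom.ker (MvPolynomial.aeval
    (fun i : SallyIdx e m n => (Polynomial.X : Polynomial ℚ) ^ (e + i.1))).toRingHom

/-- The generating set `G` for `I_{S(e,1,2)}`. -/
noncomputable def genSet (e : ℕ) : Set (MvPolynomial (SallyIdx e 1 2) ℚ) :=
  {p | ∃ i j : ℕ, 3 ≤ i ∧ i < j ∧ j ≤ e - 2 ∧
      p = sX e 1 2 i * sX e 1 2 (j+1) - sX e 1 2 (i+1) * sX e 1 2 j} ∪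
  {p | ∃ i : ℕ, 3 ≤ i ∧ i ≤ e - 2 ∧
      p = sX e 1 2 0 ^ 2 * sX e 1 2 i - sX e 1 2 (i+1) * sX e 1 2 (e-1)} ∪
  {p | ∃ i : ℕ, 3 ≤ i ∧ i ≤ e - 4 ∧
      p = sX e 1 2 0 * sX e 1 2 (i+3) - sX e 1 2 3 * sX e 1 2 i} ∪
  {sX e 1 2 0 ^ 3 - sX e 1 2 3 * sX e 1 2 (e-3)}

section NormalForm

variable {A : Type*} [CommRing A]

/-- The relations imposed by `genSet e`, for a family `y` of elements of a commutative ring. -/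
structure SallyRelations (e : ℕ) (y : ℕ → A) : Prop where
  exchange : ∀ i j, 3 ≤ i → i < j → j ≤ e - 2 → y i * y (j + 1) = y (i + 1) * y j
  sq_mul : ∀ i, 3 ≤ i → i ≤ e - 2 → y 0 ^ 2 * y i = y (i + 1) * y (e - 1)
  zero_mul : ∀ i, 3 ≤ i → i ≤ e - 4 → y 0 * y (i + 3) = y 3 * y i
  cube : y 0 ^ 3 = y 3 * y (e - 3)

/-- The standard form of a product of total weight `w`: a power of `y 0` times the product
attached to the element of the Apéry set of `S(e,1,2)` congruent to `w` modulo `e`. -/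
def sallyNormalForm (e : ℕ) (y : ℕ → A) (w : ℕ) : A :=
  if w % e = 0 then y 0 ^ (w / e)
  else if w % e = 1 then y 0 ^ (w / e - 3) * (y 3 * y (e - 2))
  else if w % e = 2 then y 0 ^ (w / e - 3) * (y 3 * y (e - 1))
  else y 0 ^ (w / e - 1) * y (w % e)

/-- `z` is a standard product of weight `w`. -/
def IsSallyStandard (e : ℕ) (y : ℕ → A) (w : ℕ) (z : A) : Prop :=
  ∃ a : ℕ, (w = a * e ∧ z = y 0 ^ a) ∨
    (∃ i, 3 ≤ i ∧ i < e ∧ w = (a + 1) * e + i ∧ z = y 0 ^ a * y i) ∨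
    (w = (a + 3) * e + 1 ∧ z = y 0 ^ a * (y 3 * y (e - 2))) ∨
    (w = (a + 3) * e + 2 ∧ z = y 0 ^ a * (y 3 * y (e - 1)))

theorem IsSallyStandard.eq_normalForm {e : ℕ} (he : 10 ≤ e) {y : ℕ → A} {w : ℕ} {z : A}
    (h : IsSallyStandard e y w z) : z = sallyNormalForm e y w := by
  have mod_eq : ∀ b r, r < e → (b * e + r) % e = r := fun b r hr => by
    rw [mul_comm, Nat.mul_add_mod, Nat.mod_eq_of_lt hr]
  have div_eq : ∀ b r, r < e → (b * e + r) / e = b := fun b r hr => by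
    rw [mul_comm, Nat.mul_add_div (by omega), Nat.div_eq_of_lt hr, add_zero]
  obtain ⟨a, ⟨rfl, rfl⟩ | ⟨i, hi, hie, rfl, rfl⟩ | ⟨rfl, rfl⟩ | ⟨rfl, rfl⟩⟩ := h
  · have h1 := mod_eq a 0 (by omega)
    have h2 := div_eq a 0 (by omega)
    rw [add_zero] at h1 h2
    rw [sallyNormalForm, h1, h2, if_pos rfl]
  · rw [sallyNormalForm, mod_eq _ _ hie, div_eq _ _ hie, if_neg (by omega), if_neg (by omega),
      if_neg (by omega), Nat.add_sub_cancel]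
  · rw [sallyNormalForm, mod_eq _ _ (by omega), div_eq _ _ (by omega), if_neg (by omega),
      if_pos rfl, Nat.add_sub_cancel]
  · rw [sallyNormalForm, mod_eq _ _ (by omega), div_eq _ _ (by omega), if_neg (by omega),
      if_neg (by omega), if_pos rfl, Nat.add_sub_cancel]

namespace SallyRelations

variable {e : ℕ} {y : ℕ → A}

theorem exchange' (h : SallyRelations e y) {i j : ℕ} (hi : 3 ≤ i) (hie : i ≤ e - 2)
    (hj : 3 ≤ j) (hje : j ≤ e - 2) : y i * y (j + 1) = y (i + 1) * y j := by
  rcases lt_trichotomy i j with hij | rfl | hij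
  · exact h.exchange i j hi hij hje
  · exact mul_comm _ _
  · rw [mul_comm, ← h.exchange j i hj hij hie, mul_comm]

theorem slide (h : SallyRelations e y) (k : ℕ) : ∀ i j : ℕ, 3 ≤ i → 3 ≤ j → i + k ≤ e - 1 →
    j + k ≤ e - 1 → y (i + k) * y j = y i * y (j + k) := by
  induction k with
  | zero => intros; rfl
  | succ k ih =>
    intro i j hi hj hik hjk
    have h1 := ih (i + 1) j (by omega) hj (by omega) (by omega)
    have h2 := h.exchange' (i := i) (j := j + k) hi (by omega) (by omega) (by omega)
    rw [show i + (k + 1) = i + 1 + k by omega, h1, ← h2, add_assoc]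

theorem mul_eq_mul (h : SallyRelations e y) {i j i' j' : ℕ} (hi : 3 ≤ i) (hie : i < e)
    (hj : 3 ≤ j) (hje : j < e) (hi' : 3 ≤ i') (hie' : i' < e) (hj' : 3 ≤ j') (hje' : j' < e)
    (hs : i + j = i' + j') : y i * y j = y i' * y j' := by
  rcases le_total i' i with hle | hle
  · have h1 := h.slide (i - i') i' j hi' hj (by omega) (by omega)
    rwa [show i' + (i - i') = i by omega, show j + (i - i') = j' by omega] at h1
  · have h1 := h.slide (i' - i) i j' hi hj' (by omega) (by omega)
    rw [show i + (i' - i) = i' by omega, show j' + (i' - i) = j by omega] at h1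
    exact h1.symm

theorem mul_of_lt (h : SallyRelations e y) {i j : ℕ} (hi : 3 ≤ i) (hj : 3 ≤ j)
    (hs : i + j < e) : y i * y j = y 0 * y (i + j) := by
  have h1 := h.zero_mul (i + j - 3) (by omega) (by omega)
  rw [show i + j - 3 + 3 = i + j by omega] at h1
  rw [h1]
  apply h.mul_eq_mul <;> omega

theorem mul_of_eq (h : SallyRelations e y) {i j : ℕ} (hi : 3 ≤ i) (hj : 3 ≤ j)
    (hs : i + j = e) : y i * y j = y 0 ^ 3 := by
  rw [h.cube]
  apply h.mul_eq_mul <;> omega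

theorem mul_of_gt (h : SallyRelations e y) {i j r : ℕ} (hi : 3 ≤ i) (hie : i < e) (hj : 3 ≤ j)
    (hje : j < e) (hr : 3 ≤ r) (hs : i + j = e + r) : y i * y j = y 0 ^ 2 * y r := by
  rw [h.sq_mul r hr (by omega)]
  apply h.mul_eq_mul <;> omega

theorem isStandard_mul (h : SallyRelations e y) (he : 10 ≤ e) {w : ℕ} {z : A}
    (hz : IsSallyStandard e y w z) {i : ℕ} (hie : i < e) (hi1 : i ≠ 1) (hi2 : i ≠ 2) :
    IsSallyStandard e y (w + (e + i)) (z * y i) := by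
  rcases Nat.eq_zero_or_pos i with rfl | hpos
  · obtain ⟨a, ⟨rfl, rfl⟩ | ⟨j, hj, hje, rfl, rfl⟩ | ⟨rfl, rfl⟩ | ⟨rfl, rfl⟩⟩ := hz
    · exact ⟨a + 1, Or.inl ⟨by ring, by ring⟩⟩
    · exact ⟨a + 1, Or.inr (Or.inl ⟨j, hj, hje, by ring, by ring⟩)⟩
    · exact ⟨a + 1, Or.inr (Or.inr (Or.inl ⟨by ring, by ring⟩))⟩
    · exact ⟨a + 1, Or.inr (Or.inr (Or.inr ⟨by ring, by ring⟩))⟩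
  have hi : 3 ≤ i := by omega
  obtain ⟨a, ⟨rfl, rfl⟩ | ⟨j, hj, hje, rfl, rfl⟩ | ⟨rfl, rfl⟩ | ⟨rfl, rfl⟩⟩ := hz
  · exact ⟨a, Or.inr (Or.inl ⟨i, hi, hie, by ring, rfl⟩)⟩
  · rw [mul_assoc]
    rcases lt_trichotomy (j + i) e with hs | hs | hs
    · rw [h.mul_of_lt hj hi hs]
      exact ⟨a + 1, Or.inr (Or.inl ⟨j + i, by omega, hs, by ring, by ring⟩)⟩
    · rw [h.mul_of_eq hj hi hs]
      exact ⟨a + 3, Or.inl ⟨by linear_combination hs, by ring⟩⟩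
    · by_cases h1 : j + i = e + 1
      · rw [h.mul_eq_mul hj hje hi hie (i' := 3) (j' := e - 2) (by omega) (by omega) (by omega)
          (by omega) (by omega)]
        exact ⟨a, Or.inr (Or.inr (Or.inl ⟨by linear_combination h1, rfl⟩))⟩
      by_cases h2 : j + i = e + 2
      · rw [h.mul_eq_mul hj hje hi hie (i' := 3) (j' := e - 1) (by omega) (by omega) (by omega)
          (by omega) (by omega)]
        exact ⟨a, Or.inr (Or.inr (Or.inr ⟨by linear_combination h2, rfl⟩))⟩
      obtain ⟨r, hr⟩ := Nat.exists_eq_add_of_lt hs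
      rw [h.mul_of_gt hj hje hi hie (r := r + 1) (by omega) (by omega)]
      exact ⟨a + 2, Or.inr (Or.inl ⟨r + 1, by omega, by omega, by linear_combination hr, by ring⟩)⟩
  · rcases lt_trichotomy (3 + i) e with hs | hs | hs
    · have h1 := h.mul_of_lt le_rfl hi hs
      have h2 := h.mul_of_gt (i := 3 + i) (j := e - 2) (r := i + 1) (by omega) (by omega) (by omega)
        (by omega) (by omega) (by omega)
      exact ⟨a + 3, Or.inr (Or.inl ⟨i + 1, by omega, by omega, by ring, by
        linear_combination y 0 ^ a * y (e - 2) * h1 + y 0 ^ (a + 1) * h2⟩)⟩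
    · have h1 := h.mul_of_eq le_rfl hi hs
      exact ⟨a + 3, Or.inr (Or.inl ⟨e - 2, by omega, by omega, by
        rw [show e - 2 = i + 1 by omega]; ring, by
        linear_combination y 0 ^ a * y (e - 2) * h1⟩)⟩
    · obtain rfl | rfl : i = e - 2 ∨ i = e - 1 := by omega
      · have h1 := h.mul_of_gt (i := e - 2) (j := e - 2) (r := e - 4) (by omega) (by omega)
          (by omega) (by omega) (by omega) (by omega)
        have h2 := h.mul_of_lt (i := 3) (j := e - 4) (by omega) (by omega) (by omega)
        rw [show 3 + (e - 4) = e - 1 by omega] at h2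
        refine ⟨a + 3, Or.inr (Or.inl ⟨e - 1, by omega, by omega, ?_, by
          linear_combination y 0 ^ a * y 3 * h1 + y 0 ^ (a + 2) * h2⟩)⟩
        rw [show e - 1 = e - 2 + 1 by omega]; ring
      · have h1 := h.mul_of_gt (i := e - 2) (j := e - 1) (r := e - 3) (by omega) (by omega)
          (by omega) (by omega) (by omega) (by omega)
        have h2 := h.cube
        refine ⟨a + 5, Or.inl ⟨?_, by
          linear_combination y 0 ^ a * y 3 * h1 - y 0 ^ (a + 2) * h2⟩⟩
        have h3 : e - 1 + 1 = e := by omega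
        linear_combination h3
  · rcases lt_trichotomy (3 + i) e with hs | hs | hs
    · have h1 := h.mul_of_lt le_rfl hi hs
      have h2 := h.mul_of_gt (i := 3 + i) (j := e - 1) (r := i + 2) (by omega) (by omega) (by omega)
        (by omega) (by omega) (by omega)
      exact ⟨a + 3, Or.inr (Or.inl ⟨i + 2, by omega, by omega, by ring, by
        linear_combination y 0 ^ a * y (e - 1) * h1 + y 0 ^ (a + 1) * h2⟩)⟩
    · have h1 := h.mul_of_eq le_rfl hi hs
      exact ⟨a + 3, Or.inr (Or.inl ⟨e - 1, by omega, by omega, by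
        rw [show e - 1 = i + 2 by omega]; ring, by
        linear_combination y 0 ^ a * y (e - 1) * h1⟩)⟩
    · obtain rfl | rfl : i = e - 2 ∨ i = e - 1 := by omega
      · have h1 := h.mul_of_gt (i := e - 1) (j := e - 2) (r := e - 3) (by omega) (by omega)
          (by omega) (by omega) (by omega) (by omega)
        have h2 := h.cube
        refine ⟨a + 5, Or.inl ⟨?_, by
          linear_combination y 0 ^ a * y 3 * h1 - y 0 ^ (a + 2) * h2⟩⟩
        have h3 : e - 2 + 2 = e := by omega
        linear_combination h3
      · have h1 := h.mul_of_gt (i := e - 1) (j := e - 1) (r := e - 2) (by omega) (by omega)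
          (by omega) (by omega) (by omega) (by omega)
        refine ⟨a + 2, Or.inr (Or.inr (Or.inl ⟨?_, by
          linear_combination y 0 ^ a * y 3 * h1⟩))⟩
        have h3 : e - 1 + 1 = e := by omega
        linear_combination h3

end SallyRelations

end NormalForm

theorem sX_of_valid {e m n i : ℕ} (h : i < e ∧ i ≠ m ∧ i ≠ n) : sX e m n i = X ⟨i, h⟩ :=
  dif_pos h

theorem genSet_subset_sallyIdeal {e : ℕ} (he : 10 ≤ e) :
    genSet e ⊆ (sallyIdeal e 1 2 : Set (MvPolynomial (SallyIdx e 1 2) ℚ)) := by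
  have key : ∀ i, i < e → i ≠ 1 → i ≠ 2 → (aeval (fun i : SallyIdx e 1 2 =>
      (Polynomial.X : Polynomial ℚ) ^ (e + i.1))) (sX e 1 2 i) = Polynomial.X ^ (e + i) := by
    intro i h0 h1 h2
    rw [sX_of_valid ⟨h0, h1, h2⟩, aeval_X]
  rintro p (((⟨i, j, hi, hij, hj, rfl⟩ | ⟨i, hi, hie, rfl⟩) | ⟨i, hi, hie, rfl⟩) | rfl) <;>
    change (aeval _) _ = _ <;>
    simp only [map_sub, map_mul, map_pow]
  · rw [key i, key (j + 1), key (i + 1), key j] <;> first | omega | ring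
  · rw [key i, key 0, key (i + 1), key (e - 1)] <;> try omega
    rw [← pow_mul, ← pow_add, ← pow_add, sub_eq_zero]
    congr 1
    omega
  · rw [key i, key 0, key (i + 3), key 3] <;> first | omega | ring
  · rw [key 0, key 3, key (e - 3)] <;> try omega
    rw [← pow_mul, ← pow_add, sub_eq_zero]
    congr 1
    omega

theorem sallyRelations_quotient (e : ℕ) :
    SallyRelations e (fun i => Ideal.Quotient.mk (Ideal.span (genSet e)) (sX e 1 2 i)) where
  exchange i j hi hij hj := by
    simp only [← map_mul]
    exact Ideal.Quotient.eq.2 (Ideal.subset_span (Or.inl (Or.inl (Or.inl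
      ⟨i, j, hi, hij, hj, rfl⟩))))
  sq_mul i hi hie := by
    simp only [← map_mul, ← map_pow]
    exact Ideal.Quotient.eq.2 (Ideal.subset_span (Or.inl (Or.inl (Or.inr ⟨i, hi, hie, rfl⟩))))
  zero_mul i hi hie := by
    simp only [← map_mul]
    exact Ideal.Quotient.eq.2 (Ideal.subset_span (Or.inl (Or.inr ⟨i, hi, hie, rfl⟩)))
  cube := by
    simp only [← map_mul, ← map_pow]
    exact Ideal.Quotient.eq.2 (Ideal.subset_span (Or.inr rfl))

/-- Modulo `genSet e`, a monomial is standard of weight its degree under `x_i ↦ t^{e+i}`. -/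
theorem exists_isSallyStandard_monomial {e : ℕ} (he : 10 ≤ e) (n : ℕ) :
    ∀ d : SallyIdx e 1 2 →₀ ℕ, d.degree = n →
      ∃ w, aeval (fun i : SallyIdx e 1 2 => (Polynomial.X : Polynomial ℚ) ^ (e + i.1))
          (monomial d (1 : ℚ)) = Polynomial.X ^ w ∧
        IsSallyStandard e (fun i => Ideal.Quotient.mk (Ideal.span (genSet e)) (sX e 1 2 i)) w
          (Ideal.Quotient.mk (Ideal.span (genSet e)) (monomial d 1)) := by
  induction n with
  | zero =>
    intro d hd
    obtain rfl := (Finsupp.degree_eq_zero_iff d).1 hd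
    exact ⟨0, by simp, 0, Or.inl ⟨by simp, by simp⟩⟩
  | succ n ih =>
    intro d hd
    have hd0 : d ≠ 0 := by
      rintro rfl
      simp at hd
    obtain ⟨i, hi⟩ := Finsupp.ne_iff.1 hd0
    obtain ⟨d, rfl⟩ : ∃ d', d = d' + Finsupp.single i 1 :=
      ⟨d - Finsupp.single i 1, (tsub_add_cancel_of_le
        (Finsupp.single_le_iff.2 (Nat.one_le_iff_ne_zero.2 hi))).symm⟩
    obtain ⟨w, hw, hstd⟩ := ih d (by
      rw [map_add, Finsupp.degree_single] at hd
      omega)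
    refine ⟨w + (e + i.1), ?_, ?_⟩
    · rw [monomial_add_single, pow_one, map_mul, hw, aeval_X, ← pow_add]
    · rw [monomial_add_single, pow_one, map_mul]
      have h := (sallyRelations_quotient e).isStandard_mul he hstd i.2.1 i.2.2.1 i.2.2.2
      rwa [sX_of_valid i.2] at h

theorem sallyIdeal_le_span_genSet {e : ℕ} (he : 10 ≤ e) :
    sallyIdeal e 1 2 ≤ Ideal.span (genSet e) := by
  let y := fun i => Ideal.Quotient.mk (Ideal.span (genSet e)) (sX e 1 2 i)
  let L : Polynomial ℚ →ₗ[ℚ] MvPolynomial (SallyIdx e 1 2) ℚ ⧸ Ideal.span (genSet e) :=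
    (Polynomial.basisMonomials ℚ).constr ℚ (sallyNormalForm e y)
  have hL : ∀ w, L (Polynomial.X ^ w) = sallyNormalForm e y w := fun w => by
    have h := (Polynomial.basisMonomials ℚ).constr_basis ℚ (sallyNormalForm e y) w
    simpa only [Polynomial.coe_basisMonomials, Polynomial.monomial_one_right_eq_X_pow] using h
  have hcomp : L ∘ₗ (aeval (fun i : SallyIdx e 1 2 =>
      (Polynomial.X : Polynomial ℚ) ^ (e + i.1))).toLinearMap =
      (Ideal.Quotient.mkₐ ℚ (Ideal.span (genSet e))).toLinearMap := by
    refine (basisMonomials (SallyIdx e 1 2) ℚ).ext fun d => ?_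
    obtain ⟨w, hw, hstd⟩ := exists_isSallyStandard_monomial he _ d rfl
    simp only [coe_basisMonomials, LinearMap.comp_apply, AlgHom.toLinearMap_apply]
    rw [hw, hL, ← hstd.eq_normalForm he]
    rfl
  intro f hf
  have hf0 : aeval (fun i : SallyIdx e 1 2 => (Polynomial.X : Polynomial ℚ) ^ (e + i.1)) f = 0 := hf
  have h := LinearMap.congr_fun hcomp f
  simp only [LinearMap.comp_apply, AlgHom.toLinearMap_apply] at h
  rw [hf0, map_zero] at h
  exact Ideal.Quotient.eq_zero_iff_mem.1 h.symm

section Minimality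

variable {e : ℕ}

open Classical in
/-- The sum of the coefficients of the quadratic monomials `x_a x_b` with `a + b = s` and
`k ≤ a, b`. -/
noncomputable def quadraticCoeffSum (e k s : ℕ) : MvPolynomial (SallyIdx e 1 2) ℚ →ₗ[ℚ] ℚ :=
  (basisMonomials (SallyIdx e 1 2) ℚ).constr ℚ fun d =>
    if d.degree = 2 ∧ Finsupp.weight (fun i : SallyIdx e 1 2 => i.1) d = s ∧
      ∀ i ∈ d.support, k ≤ i.1 then 1 else 0

open Classical in
theorem quadraticCoeffSum_monomial (k s : ℕ) (d : SallyIdx e 1 2 →₀ ℕ) (c : ℚ) :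
    quadraticCoeffSum e k s (monomial d c) =
      if d.degree = 2 ∧ Finsupp.weight (fun i : SallyIdx e 1 2 => i.1) d = s ∧
        ∀ i ∈ d.support, k ≤ i.1 then c else 0 := by
  have h1 : monomial d c = c • basisMonomials (SallyIdx e 1 2) ℚ d := by
    simp [smul_monomial]
  rw [h1, map_smul, quadraticCoeffSum, Module.Basis.constr_basis, smul_eq_mul, mul_ite, mul_one,
    mul_zero]

theorem quadraticCoeffSum_mul (k s : ℕ) {i j : ℕ} (hi : i < e ∧ i ≠ 1 ∧ i ≠ 2)
    (hj : j < e ∧ j ≠ 1 ∧ j ≠ 2) (q : MvPolynomial (SallyIdx e 1 2) ℚ) :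
    quadraticCoeffSum e k s (q * (sX e 1 2 i * sX e 1 2 j)) =
      if i + j = s ∧ k ≤ i ∧ k ≤ j then coeff 0 q else 0 := by
  classical
  rw [sX_of_valid hi, sX_of_valid hj]
  induction q using MvPolynomial.induction_on' with
  | monomial d c =>
    rw [X, X, monomial_mul, monomial_mul, quadraticCoeffSum_monomial, coeff_monomial]
    by_cases hd : d = 0
    · subst hd
      have hsupp : (∀ l ∈ (Finsupp.single (⟨i, hi⟩ : SallyIdx e 1 2) 1 +
          Finsupp.single (⟨j, hj⟩ : SallyIdx e 1 2) 1).support, k ≤ l.1) ↔ k ≤ i ∧ k ≤ j := by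
        constructor
        · intro h
          exact ⟨h ⟨i, hi⟩ (by simp), h ⟨j, hj⟩ (by simp)⟩
        · rintro ⟨h1, h2⟩ l hl
          rcases Finset.mem_union.1 (Finsupp.support_add hl) with h | h <;>
            rw [Finset.mem_singleton.1 (Finsupp.support_single_subset h)] <;> assumption
      rw [zero_add]
      simp only [hsupp]
      simp [Finsupp.weight_single]
    · have := (Finsupp.degree_eq_zero_iff d).not.2 hd
      rw [if_neg hd, if_neg, ite_self]
      simp only [map_add, Finsupp.degree_single]
      omega
  | add p q hp hq =>
    rw [add_mul, map_add, hp, hq, coeff_add]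
    split_ifs <;> simp

theorem quadraticCoeffSum_mul_mul (k s : ℕ) {i j l : ℕ} (hi : i < e ∧ i ≠ 1 ∧ i ≠ 2)
    (hj : j < e ∧ j ≠ 1 ∧ j ≠ 2) (hl : l < e ∧ l ≠ 1 ∧ l ≠ 2)
    (q : MvPolynomial (SallyIdx e 1 2) ℚ) :
    quadraticCoeffSum e k s (q * (sX e 1 2 l * (sX e 1 2 i * sX e 1 2 j))) = 0 := by
  rw [← mul_assoc, quadraticCoeffSum_mul k s hi hj, sX_of_valid hl, ← constantCoeff_eq]
  simp

theorem quadraticCoeffSum_eq_zero_of_mem_span (k s : ℕ) {G : Set (MvPolynomial (SallyIdx e 1 2) ℚ)}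
    (hG : ∀ g ∈ G, ∀ q, quadraticCoeffSum e k s (q * g) = 0)
    {f : MvPolynomial (SallyIdx e 1 2) ℚ} (hf : f ∈ Ideal.span G) :
    quadraticCoeffSum e k s f = 0 := by
  suffices h : ∀ q, quadraticCoeffSum e k s (q * f) = 0 by simpa using h 1
  induction hf using Submodule.span_induction with
  | mem g hg => exact hG g hg
  | zero => simp
  | add f g _ _ hf hg => intro q; rw [mul_add, map_add, hf, hg, add_zero]
  | smul a f _ hf => intro q; rw [smul_eq_mul, ← mul_assoc, hf]

theorem quadraticCoeffSum_mul_exchange (k s : ℕ) {i j : ℕ} (hi : 3 ≤ i) (hij : i < j)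
    (hj : j ≤ e - 2) (q : MvPolynomial (SallyIdx e 1 2) ℚ) :
    quadraticCoeffSum e k s
        (q * (sX e 1 2 i * sX e 1 2 (j + 1) - sX e 1 2 (i + 1) * sX e 1 2 j)) =
      if i + j + 1 = s ∧ k = i + 1 then -coeff 0 q else 0 := by
  rw [mul_sub, map_sub, quadraticCoeffSum_mul _ _ (by omega) (by omega),
    quadraticCoeffSum_mul _ _ (by omega) (by omega)]
  split_ifs <;> first | omega | simp

theorem quadraticCoeffSum_mul_sq_mul {k : ℕ} (s : ℕ) {i : ℕ} (hi : 3 ≤ i)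
    (hie : i ≤ e - 2) (q : MvPolynomial (SallyIdx e 1 2) ℚ) :
    quadraticCoeffSum e k s
        (q * (sX e 1 2 0 ^ 2 * sX e 1 2 i - sX e 1 2 (i + 1) * sX e 1 2 (e - 1))) =
      if i + e = s ∧ k ≤ i + 1 then -coeff 0 q else 0 := by
  rw [mul_sub, map_sub, pow_two, mul_assoc (sX e 1 2 0),
    quadraticCoeffSum_mul_mul _ _ (by omega) (by omega) (by omega),
    quadraticCoeffSum_mul _ _ (by omega) (by omega)]
  split_ifs <;> first | omega | simp

theorem quadraticCoeffSum_mul_zero_mul {k : ℕ} (s : ℕ) (hk : 3 ≤ k) {i : ℕ} (hi : 3 ≤ i)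
    (hie : i ≤ e - 4) (q : MvPolynomial (SallyIdx e 1 2) ℚ) :
    quadraticCoeffSum e k s
        (q * (sX e 1 2 0 * sX e 1 2 (i + 3) - sX e 1 2 3 * sX e 1 2 i)) =
      if i + 3 = s ∧ k = 3 then -coeff 0 q else 0 := by
  rw [mul_sub, map_sub, quadraticCoeffSum_mul _ _ (by omega) (by omega),
    quadraticCoeffSum_mul _ _ (by omega) (by omega)]
  split_ifs <;> first | omega | simp

theorem quadraticCoeffSum_mul_cube (he : 10 ≤ e) {k : ℕ} (s : ℕ) (hk : 3 ≤ k)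
    (q : MvPolynomial (SallyIdx e 1 2) ℚ) :
    quadraticCoeffSum e k s
        (q * (sX e 1 2 0 ^ 3 - sX e 1 2 3 * sX e 1 2 (e - 3))) =
      if e = s ∧ k = 3 then -coeff 0 q else 0 := by
  rw [mul_sub, map_sub, pow_succ', pow_two,
    quadraticCoeffSum_mul_mul _ _ (by omega) (by omega) (by omega),
    quadraticCoeffSum_mul _ _ (by omega) (by omega)]
  split_ifs <;> first | omega | simp

/-- Every element of `genSet e` is separated from all the others by some
`quadraticCoeffSum e k s`. -/
theorem exists_quadraticCoeffSum_separating (he : 10 ≤ e) {p : MvPolynomial (SallyIdx e 1 2) ℚ}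
    (hp : p ∈ genSet e) : ∃ k s, quadraticCoeffSum e k s (1 * p) ≠ 0 ∧
      ∀ g ∈ genSet e, g ≠ p → ∀ q, quadraticCoeffSum e k s (q * g) = 0 := by
  obtain ((⟨i, j, hi, hij, hj, rfl⟩ | ⟨i, hi, hie, rfl⟩) | ⟨i, hi, hie, rfl⟩) | rfl := hp
  · refine ⟨i + 1, i + j + 1, ?_, ?_⟩
    · rw [quadraticCoeffSum_mul_exchange _ _ hi hij hj, if_pos (by omega)]
      simp
    rintro g (((⟨i', j', hi', hij', hj', rfl⟩ | ⟨i', hi', hie', rfl⟩) | ⟨i', hi', hie', rfl⟩) | rfl)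
      hne q
    · rw [quadraticCoeffSum_mul_exchange _ _ hi' hij' hj', if_neg]
      rintro ⟨h1, h2⟩
      obtain rfl : i = i' := by omega
      obtain rfl : j = j' := by omega
      exact hne rfl
    · rw [quadraticCoeffSum_mul_sq_mul _ hi' hie', if_neg (by omega)]
    · rw [quadraticCoeffSum_mul_zero_mul _ (by omega) hi' hie', if_neg (by omega)]
    · rw [quadraticCoeffSum_mul_cube he _ (by omega), if_neg (by omega)]
  · refine ⟨3, i + e, ?_, ?_⟩
    · rw [quadraticCoeffSum_mul_sq_mul _ hi hie, if_pos (by omega)]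
      simp
    rintro g (((⟨i', j', hi', hij', hj', rfl⟩ | ⟨i', hi', hie', rfl⟩) | ⟨i', hi', hie', rfl⟩) | rfl)
      hne q
    · rw [quadraticCoeffSum_mul_exchange _ _ hi' hij' hj', if_neg (by omega)]
    · rw [quadraticCoeffSum_mul_sq_mul _ hi' hie', if_neg]
      rintro ⟨h1, h2⟩
      obtain rfl : i = i' := by omega
      exact hne rfl
    · rw [quadraticCoeffSum_mul_zero_mul _ le_rfl hi' hie', if_neg (by omega)]
    · rw [quadraticCoeffSum_mul_cube he _ le_rfl, if_neg (by omega)]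
  · refine ⟨3, i + 3, ?_, ?_⟩
    · rw [quadraticCoeffSum_mul_zero_mul _ le_rfl hi hie, if_pos (by omega)]
      simp
    rintro g (((⟨i', j', hi', hij', hj', rfl⟩ | ⟨i', hi', hie', rfl⟩) | ⟨i', hi', hie', rfl⟩) | rfl)
      hne q
    · rw [quadraticCoeffSum_mul_exchange _ _ hi' hij' hj', if_neg (by omega)]
    · rw [quadraticCoeffSum_mul_sq_mul _ hi' hie', if_neg (by omega)]
    · rw [quadraticCoeffSum_mul_zero_mul _ le_rfl hi' hie', if_neg]
      rintro ⟨h1, h2⟩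
      obtain rfl : i = i' := by omega
      exact hne rfl
    · rw [quadraticCoeffSum_mul_cube he _ le_rfl, if_neg (by omega)]
  · refine ⟨3, e, ?_, ?_⟩
    · rw [quadraticCoeffSum_mul_cube he _ le_rfl, if_pos (by omega)]
      simp
    rintro g (((⟨i', j', hi', hij', hj', rfl⟩ | ⟨i', hi', hie', rfl⟩) | ⟨i', hi', hie', rfl⟩) | rfl)
      hne q
    · rw [quadraticCoeffSum_mul_exchange _ _ hi' hij' hj', if_neg (by omega)]
    · rw [quadraticCoeffSum_mul_sq_mul _ hi' hie', if_neg (by omega)]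
    · rw [quadraticCoeffSum_mul_zero_mul _ le_rfl hi' hie', if_neg (by omega)]
    · exact absurd rfl hne

end Minimality

theorem stmt0 (e : ℕ) (he : 10 ≤ e) :
    Ideal.span (genSet e) = sallyIdeal e 1 2 ∧
    ∀ G' : Set (MvPolynomial (SallyIdx e 1 2) ℚ), G' ⊂ genSet e →
      Ideal.span G' ≠ sallyIdeal e 1 2 := by
  refine ⟨le_antisymm (Ideal.span_le.2 (genSet_subset_sallyIdeal he))
    (sallyIdeal_le_span_genSet he), fun G' hG' heq => ?_⟩
  obtain ⟨hsub, p, hp, hpG'⟩ := Set.ssubset_iff_exists.1 hG'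
  obtain ⟨k, s, hne, hzero⟩ := exists_quadraticCoeffSum_separating he hp
  rw [one_mul] at hne
  refine hne (quadraticCoeffSum_eq_zero_of_mem_span k s (fun g hg => hzero g (hsub hg) ?_) ?_)
  · rintro rfl
    exact hpG' hg
  · rw [heq]
    exact genSet_subset_sallyIdeal he hp
end

section
/- Let e ≥ 10 and 2 ≤ n ≤ e−2 be integers. The minimal number of generators μ(I_{S(e,1,n)}) of the defining toric ideal I_{S(e,1,n)} (i.e., the smallest cardinality of a set of elements generating I_{S(e,1,n)} as an ideal of R(e,1,n)) equals C(e−2, 2) − 1 if n = 4, and equals C(e−2, 2) − 2 if n ≠ 4, where C(a,b) denotes the binomial coefficient. -/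
open MvPolynomial

/-- `i` indexes a variable of `R(e,1,n)`. -/
def SallyValid (e n i : ℕ) : Prop := i < e ∧ i ≠ 1 ∧ i ≠ n

/-- Index sums `c ≥ 2` such that `e + c` is not an element of the semigroup. -/
def SallyBad (e n c : ℕ) : Prop :=
  c = n ∨ c = e + 1 ∨ (n = 2 ∧ c = e + 2) ∨ (n = 3 ∧ c = e + 3)

theorem exists_split_not_sallyBad {e n i c : ℕ} (he : 10 ≤ e) (hn2 : 2 ≤ n) (hne : n ≤ e - 2)
    (hi : SallyValid e n i) (hc : SallyBad e n c)
    (h4 : 4 ≤ c) (hc4 : c ≠ 4) :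
    ∃ j k, SallyValid e n j ∧ SallyValid e n k ∧ j + k = c ∧ ¬ SallyBad e n (i + j) := by
  by_contra hcon
  have key : ∀ a, a ≤ c → (a < e ∧ a ≠ 1 ∧ a ≠ n) → (c - a < e ∧ c - a ≠ 1 ∧ c - a ≠ n) →
      (i + a = n ∨ i + a = e + 1 ∨ (n = 2 ∧ i + a = e + 2) ∨ (n = 3 ∧ i + a = e + 3)) := by
    intro a hac ha hca
    by_contra hb
    exact hcon ⟨a, c - a, ha, hca, by omega, hb⟩
  clear hcon
  unfold SallyValid at hi
  unfold SallyBad at hc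
  obtain hc | hc := hc
  · subst hc
    have key' : ∀ a, 2 ≤ a → a ≤ c - 2 → i + a = c ∨ i + a = e + 1 := by
      intro a h1 h2
      have := key a (by omega) (by omega) (by omega)
      omega
    clear key
    have h1 := key' 2 (by omega) (by omega)
    have h2 := key' (c - 2) (by omega) (by omega)
    by_cases h6 : 6 ≤ c
    · have h3 := key' 3 (by omega) (by omega)
      have h4 := key' (c - 3) (by omega) (by omega)
      clear key'
      omega
    · omega
  · by_cases hn4 : 4 ≤ n
    · obtain rfl : c = e + 1 := by omega
      have key' : ∀ a, 2 ≤ a → a ≤ e - 1 → a ≠ n → a + n ≠ e + 1 → i + a = n ∨ i + a = e + 1 := by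
        intro a h1 h2 h3 h4
        have := key a (by omega) (by omega) (by omega)
        omega
      clear key
      have h1 := key' 2 (by omega) (by omega)
      have h2 := key' 3 (by omega) (by omega)
      have h3 := key' 4 (by omega) (by omega)
      have h1' := key' (e - 1) (by omega) (by omega)
      have h2' := key' (e - 2) (by omega) (by omega)
      have h3' := key' (e - 3) (by omega) (by omega)
      clear key'
      by_cases n = e - 2 <;> by_cases n = e - 3 <;> by_cases n = 4 <;> omega
    · have key' : ∀ a, 4 ≤ a → a ≤ e - 1 → 4 ≤ c - a → c - a ≤ e - 1 →
          i + a = e + 1 ∨ i + a = e + n := by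
        intro a h1 h2 h3 h4
        have := key a (by omega) (by omega) (by omega)
        omega
      clear key
      have h3 := key' 4 (by omega) (by omega)
      have h4 := key' 5 (by omega) (by omega)
      have h5 := key' 6 (by omega) (by omega)
      clear key'
      omega

/-- The weight `∑ (e + i)` of a multiset of indices. -/
def sallyWt (e : ℕ) (s : Multiset ℕ) : ℕ := (s.map (e + ·)).sum

@[simp] theorem sallyWt_zero (e : ℕ) : sallyWt e 0 = 0 := rfl

@[simp] theorem sallyWt_cons (e i : ℕ) (s : Multiset ℕ) :
    sallyWt e (i ::ₘ s) = e + i + sallyWt e s := by simp [sallyWt]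

@[simp] theorem sallyWt_singleton (e i : ℕ) : sallyWt e {i} = e + i := by simp [sallyWt]

@[simp] theorem sallyWt_add (e : ℕ) (s t : Multiset ℕ) :
    sallyWt e (s + t) = sallyWt e s + sallyWt e t := by simp [sallyWt]

/-- The chosen factorization of the element `2e + s` of the semigroup. -/
def sallyRep (e n s : ℕ) : Multiset ℕ :=
  if s < e then (if s = n then {2, n - 2} else {0, s})
  else if s = e + 1 then (if n = 2 then {3, e - 2} else {2, e - 1})
  else if s = e + n then
    (if n = 2 then {3, e - 1} else if n = 3 then {4, e - 1} else {0, 2, n - 2})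
  else {0, 0, s - e}

section Factorizations

variable {e n : ℕ} {M : Type*} [CommMonoid M] {y : ℕ → M}

theorem exists_zero_mul_of_not_sallyBad (he : 10 ≤ e) (hn2 : 2 ≤ n)
    (hquad : ∀ i j, SallyValid e n i → SallyValid e n j →
      y i * y j = ((sallyRep e n (i + j)).map y).prod)
    {j k : ℕ} (hj : SallyValid e n j) (hk : SallyValid e n k) (hb : ¬ SallyBad e n (j + k)) :
    ∃ v : Multiset ℕ, (∀ x ∈ v, SallyValid e n x) ∧ y j * y k = y 0 * (v.map y).prod ∧
      sallyWt e (0 ::ₘ v) = (e + j) + (e + k) := by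
  rw [hquad j k hj hk]
  unfold SallyValid SallyBad at *
  unfold sallyRep
  by_cases h1 : j + k < e
  · refine ⟨{j + k}, ?_, ?_, ?_⟩
    · simp; omega
    · rw [if_pos h1, if_neg (by omega)]; simp
    · simp; omega
  · rw [if_neg h1, if_neg (by omega)]
    by_cases h2 : j + k = e + n
    · refine ⟨{2, n - 2}, ?_, ?_, ?_⟩
      · simp; omega
      · rw [if_pos h2, if_neg (by omega), if_neg (by omega)]; simp
      · simp; omega
    · refine ⟨{0, j + k - e}, ?_, ?_, ?_⟩
      · simp; omega
      · rw [if_neg h2]; simp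
      · simp; omega

theorem exists_zero_mul_of_triple (he : 10 ≤ e) (hn2 : 2 ≤ n) (hne : n ≤ e - 2)
    (hquad : ∀ i j, SallyValid e n i → SallyValid e n j →
      y i * y j = ((sallyRep e n (i + j)).map y).prod)
    (hcub : n = 4 → y 2 * (y 2 * y 2) = y 0 * (y 0 * y 6))
    {i j k : ℕ} (hi : SallyValid e n i) (hj : SallyValid e n j) (hk : SallyValid e n k) :
    ∃ v : Multiset ℕ, (∀ x ∈ v, SallyValid e n x) ∧
      y i * (y j * y k) = y 0 * (v.map y).prod ∧
      sallyWt e (0 ::ₘ v) = (e + i) + ((e + j) + (e + k)) := by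
  have good : ∀ {a b c : ℕ}, SallyValid e n a → SallyValid e n b → SallyValid e n c →
      ¬ SallyBad e n (b + c) → y i * (y j * y k) = y a * (y b * y c) →
      a + b + c = i + j + k → ∃ v : Multiset ℕ, (∀ x ∈ v, SallyValid e n x) ∧
      y i * (y j * y k) = y 0 * (v.map y).prod ∧
      sallyWt e (0 ::ₘ v) = (e + i) + ((e + j) + (e + k)) := by
    intro a b c ha hb hc hbc hy hs
    obtain ⟨v, hv, hyv, hwv⟩ := exists_zero_mul_of_not_sallyBad he hn2 hquad hb hc hbc
    refine ⟨a ::ₘ v, ?_, ?_, ?_⟩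
    · simpa using ⟨ha, hv⟩
    · rw [hy, hyv]; simp [mul_left_comm]
    · simp at hwv ⊢; omega
  by_cases hi0 : i = 0
  · subst hi0
    exact ⟨{j, k}, by simp [hj, hk], by simp, by simp⟩
  by_cases hj0 : j = 0
  · subst hj0
    exact ⟨{i, k}, by simp [hi, hk], by simp [mul_left_comm], by simp; omega⟩
  by_cases hk0 : k = 0
  · subst hk0
    exact ⟨{i, j}, by simp [hi, hj], by rw [← mul_assoc, mul_comm]; simp, by simp; omega⟩
  by_cases hb : SallyBad e n (j + k)
  swap
  · exact good hi hj hk hb rfl rfl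
  have hjk : 2 ≤ j ∧ 2 ≤ k := by unfold SallyValid at hj hk; omega
  by_cases hc4 : j + k = 4
  · obtain ⟨rfl, rfl⟩ : j = 2 ∧ k = 2 := by omega
    obtain rfl : n = 4 := by unfold SallyBad at hb; omega
    by_cases hi2 : i = 2
    · subst hi2
      refine ⟨{0, 6}, ?_, ?_, ?_⟩
      · simp [SallyValid]; omega
      · rw [hcub rfl]; simp
      · simp; omega
    by_cases hie : i = e - 1
    · have h3 : SallyValid e 4 3 := by unfold SallyValid; omega
      have he2 : SallyValid e 4 (e - 2) := by unfold SallyValid; omega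
      refine good he2 h3 hj (by unfold SallyBad; omega) ?_ (by omega)
      rw [← mul_assoc, ← mul_assoc, hquad _ _ hi hj, hquad _ _ he2 h3]
      congr 4; omega
    · exact good hj hi hk (by unfold SallyBad; omega) (mul_left_comm _ _ _) (by omega)
  · obtain ⟨j', k', hj', hk', hs, hb'⟩ :=
      exists_split_not_sallyBad he hn2 hne hi hb (by omega) hc4
    refine good hk' hi hj' hb' ?_ (by omega)
    rw [hquad _ _ hj hk, ← hs, ← hquad _ _ hj' hk']
    simp [mul_comm, mul_left_comm]

theorem sallyWt_sallyRep (he : 10 ≤ e) (hn2 : 2 ≤ n) (s : ℕ) :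
    sallyWt e (sallyRep e n s) = 2 * e + s := by
  unfold sallyRep
  split_ifs <;> simp <;> omega

theorem card_mul_le_sallyWt (s : Multiset ℕ) : e * s.card ≤ sallyWt e s := by
  induction s using Multiset.induction with
  | empty => simp
  | cons a s ih => simp [mul_add]; omega

theorem exists_zero_mul_of_three_le_card (he : 10 ≤ e) (hn2 : 2 ≤ n) (hne : n ≤ e - 2)
    (hquad : ∀ i j, SallyValid e n i → SallyValid e n j →
      y i * y j = ((sallyRep e n (i + j)).map y).prod)
    (hcub : n = 4 → y 2 * (y 2 * y 2) = y 0 * (y 0 * y 6))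
    {s : Multiset ℕ} (hs : ∀ x ∈ s, SallyValid e n x) (h3 : 3 ≤ s.card) :
    ∃ v : Multiset ℕ, (∀ x ∈ v, SallyValid e n x) ∧
      (s.map y).prod = y 0 * (v.map y).prod ∧ sallyWt e (0 ::ₘ v) = sallyWt e s := by
  obtain ⟨i, j, k, r, rfl⟩ : ∃ i j k r, s = i ::ₘ j ::ₘ k ::ₘ r := by
    induction s using Quot.inductionOn with
    | h l =>
      rcases l with _ | ⟨i, _ | ⟨j, _ | ⟨k, l⟩⟩⟩
      iterate 3 simp at h3
      exact ⟨i, j, k, l, rfl⟩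
  simp only [Multiset.mem_cons] at hs
  obtain ⟨v, hv, hyv, hwv⟩ := exists_zero_mul_of_triple he hn2 hne hquad hcub
    (hs i (by simp)) (hs j (by simp)) (hs k (by simp))
  refine ⟨v + r, ?_, ?_, ?_⟩
  · intro x hx
    obtain hx | hx := Multiset.mem_add.1 hx
    exacts [hv x hx, hs x (by simp [hx])]
  · simp only [← mul_assoc] at hyv
    simp only [Multiset.map_cons, Multiset.prod_cons, Multiset.map_add, Multiset.prod_add,
      ← mul_assoc, hyv]
  · simp at hwv ⊢; omega

theorem card_le_one_or_of_sallyWt_eq {s t : Multiset ℕ} (hs : ∀ x ∈ s, x < e)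
    (ht : ∀ x ∈ t, x < e) (hst : sallyWt e s = sallyWt e t) (h1 : s.card ≤ 1) : t = s := by
  have hc := card_mul_le_sallyWt (e := e) t
  obtain h0 | h1 : s.card = 0 ∨ s.card = 1 := by omega
  · obtain rfl := Multiset.card_eq_zero.1 h0
    have : t.card = 0 := by
      by_contra h
      obtain ⟨a, ha⟩ := Multiset.card_pos_iff_exists_mem.1 (Nat.pos_of_ne_zero h)
      have := ht a ha
      have : e * 1 ≤ e * t.card := Nat.mul_le_mul_left _ (by omega)
      simp at hst; omega
    simpa using this
  · obtain ⟨a, rfl⟩ := Multiset.card_eq_one.1 h1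
    simp at hs hst
    have : t.card < 2 := by
      by_contra h
      have : e * 2 ≤ e * t.card := Nat.mul_le_mul_left _ (by omega)
      omega
    obtain h0 | h1 : t.card = 0 ∨ t.card = 1 := by omega
    · obtain rfl := Multiset.card_eq_zero.1 h0
      simp at hst; omega
    · obtain ⟨b, rfl⟩ := Multiset.card_eq_one.1 h1
      simp at hst; simp [hst]

theorem three_le_card_sallyRep {i j : ℕ} {t : Multiset ℕ} (he : 10 ≤ e)
    (hi : SallyValid e n i) (hj : SallyValid e n j) (ht : ∀ x ∈ t, SallyValid e n x)
    (hn2 : 2 ≤ n)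
    (hw : (e + i) + (e + j) = sallyWt e t) (h3 : 3 ≤ t.card) :
    (∀ x ∈ sallyRep e n (i + j), SallyValid e n x) ∧ 3 ≤ (sallyRep e n (i + j)).card := by
  have hc := card_mul_le_sallyWt (e := e) t
  have h3' : t.card = 3 := by
    by_contra h
    have : e * 4 ≤ e * t.card := Nat.mul_le_mul_left _ (by omega)
    unfold SallyValid at *
    omega
  obtain ⟨a, b, c, rfl⟩ := Multiset.card_eq_three.1 h3'
  simp at hw ht
  unfold SallyValid at *
  unfold sallyRep
  rw [if_neg (by omega), if_neg (by omega)]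
  split_ifs
  · omega
  · omega
  · simp; omega
  · simp; omega

/-- In a commutative monoid, the quadratic relations (and one cubic relation if `n = 4`) force
any two products of the same weight to agree. -/
theorem prod_eq_prod_of_sallyWt_eq (he : 10 ≤ e) (hn2 : 2 ≤ n) (hne : n ≤ e - 2)
    (hquad : ∀ i j, SallyValid e n i → SallyValid e n j →
      y i * y j = ((sallyRep e n (i + j)).map y).prod)
    (hcub : n = 4 → y 2 * (y 2 * y 2) = y 0 * (y 0 * y 6))
    {s t : Multiset ℕ} (hs : ∀ x ∈ s, SallyValid e n x) (ht : ∀ x ∈ t, SallyValid e n x)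
    (hst : sallyWt e s = sallyWt e t) : (s.map y).prod = (t.map y).prod := by
  induction hd : sallyWt e s using Nat.strong_induction_on generalizing s t with
  | _ d ih =>
    have big : ∀ {s t : Multiset ℕ}, (∀ x ∈ s, SallyValid e n x) → (∀ x ∈ t, SallyValid e n x) →
        sallyWt e s = d → sallyWt e t = d → 3 ≤ s.card → 3 ≤ t.card →
        (s.map y).prod = (t.map y).prod := by
      intro s t hs ht hsd htd hs3 ht3
      obtain ⟨v, hv, hyv, hwv⟩ := exists_zero_mul_of_three_le_card he hn2 hne hquad hcub hs hs3
      obtain ⟨w, hw, hyw, hww⟩ := exists_zero_mul_of_three_le_card he hn2 hne hquad hcub ht ht3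
      simp at hwv hww
      rw [hyv, hyw, ih (sallyWt e v) (by omega) hv hw (by omega) rfl]
    have mixed : ∀ {s t : Multiset ℕ}, (∀ x ∈ s, SallyValid e n x) →
        (∀ x ∈ t, SallyValid e n x) →
        sallyWt e s = d → sallyWt e t = d → s.card = 2 → 2 ≤ t.card →
        (s.map y).prod = (t.map y).prod := by
      intro s t hs ht hsd htd hs2 ht2
      obtain ⟨i, j, rfl⟩ := Multiset.card_eq_two.1 hs2
      simp at hs hsd
      have hR : (Multiset.map y {i, j}).prod = ((sallyRep e n (i + j)).map y).prod := by
        rw [← hquad i j hs.1 hs.2]; simp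
      rw [hR]
      obtain h2 | h3 := ht2.eq_or_lt'
      · obtain ⟨k, l, rfl⟩ := Multiset.card_eq_two.1 h2
        simp at ht htd
        have : i + j = k + l := by omega
        rw [this, ← hquad k l ht.1 ht.2]; simp
      · obtain ⟨hRv, hR3⟩ := three_le_card_sallyRep he hs.1 hs.2 ht hn2 (by omega) h3
        exact big hRv ht (by rw [sallyWt_sallyRep he hn2]; omega) htd hR3 h3
    by_cases hs1 : s.card ≤ 1
    · rw [card_le_one_or_of_sallyWt_eq (fun x hx => (hs x hx).1) (fun x hx => (ht x hx).1) hst hs1]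
    by_cases ht1 : t.card ≤ 1
    · rw [card_le_one_or_of_sallyWt_eq (fun x hx => (ht x hx).1) (fun x hx => (hs x hx).1)
        hst.symm ht1]
    by_cases hs2 : s.card = 2
    · exact mixed hs ht hd (by omega) hs2 (by omega)
    by_cases ht2 : t.card = 2
    · exact (mixed ht hs (by omega) hd ht2 (by omega)).symm
    exact big hs ht hd (by omega) (by omega) (by omega)

end Factorizations

section BinomialGenerators

variable {σ : Type*} {w : σ → ℕ}

theorem aeval_X_pow_monomial (a : σ →₀ ℕ) (c : ℚ) :
    aeval (fun i => (Polynomial.X : Polynomial ℚ) ^ w i) (monomial a c) =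
      Polynomial.monomial (Finsupp.weight w a) c := by
  rw [aeval_monomial, ← Polynomial.C_mul_X_pow_eq_monomial, Finsupp.weight_apply, Finsupp.prod,
    Finsupp.sum, ← Finset.prod_pow_eq_pow_sum]
  simp [← pow_mul, mul_comm]

theorem coeff_eq_zero_of_aeval_X_pow_eq_zero {f : MvPolynomial σ ℚ} {b : σ →₀ ℕ}
    (hf : aeval (fun i => (Polynomial.X : Polynomial ℚ) ^ w i) f = 0)
    (hb : ∀ c, Finsupp.weight w c = Finsupp.weight w b → c = b) : coeff b f = 0 := by
  classical
  have h : (aeval (fun i => (Polynomial.X : Polynomial ℚ) ^ w i) f).coeff (Finsupp.weight w b) =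
      ∑ a ∈ f.support, if a = b then coeff a f else 0 := by
    conv_lhs => rw [f.as_sum, map_sum, Polynomial.finsetSum_coeff]
    refine Finset.sum_congr rfl fun a _ => ?_
    rw [aeval_X_pow_monomial, Polynomial.coeff_monomial]
    exact if_congr ⟨hb a, fun h => h ▸ rfl⟩ rfl rfl
  rw [hf, Polynomial.coeff_zero, Finset.sum_ite_eq'] at h
  by_contra h0
  rw [if_pos (mem_support_iff.2 h0)] at h
  exact h0 h.symm

theorem coeff_mul_eq_of_forall_lt {p g : MvPolynomial σ ℚ} {b : σ →₀ ℕ}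
    (hg : ∀ b' < b, coeff b' g = 0) : coeff b (p * g) = coeff 0 p * coeff b g := by
  classical
  rw [coeff_mul]
  refine Finset.sum_eq_single (0, b) ?_ (by simp)
  rintro ⟨a, c⟩ hac hne
  rw [Finset.HasAntidiagonal.mem_antidiagonal] at hac
  dsimp only at hac ⊢
  rw [hg c (lt_of_le_of_ne (hac ▸ le_add_self) ?_), mul_zero]
  rintro rfl
  exact hne (by simpa using hac)

theorem ker_aeval_X_pow_le {J : Ideal (MvPolynomial σ ℚ)}
    (hJ : ∀ a c, Finsupp.weight w a = Finsupp.weight w c →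
      (monomial a 1 : MvPolynomial σ ℚ) - monomial c 1 ∈ J) :
    RingHom.ker (aeval (R := ℚ) fun i => (Polynomial.X : Polynomial ℚ) ^ w i).toRingHom ≤ J := by
  classical
  choose z hz using fun d : ℕ =>
    (show ∃ z : MvPolynomial σ ℚ ⧸ J, ∀ a : σ →₀ ℕ, Finsupp.weight w a = d →
        Ideal.Quotient.mk J (monomial a 1) = z by
      by_cases h : ∃ c : σ →₀ ℕ, Finsupp.weight w c = d
      · obtain ⟨c, hc⟩ := h
        exact ⟨_, fun a ha => Ideal.Quotient.eq.2 (hJ a c (ha.trans hc.symm))⟩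
      · exact ⟨0, fun a ha => (h ⟨a, ha⟩).elim⟩)
  let ψ : Polynomial ℚ →ₗ[ℚ] MvPolynomial σ ℚ ⧸ J :=
    (Polynomial.basisMonomials ℚ).constr ℚ z
  have hψ : ψ ∘ₗ (aeval (R := ℚ) fun i => (Polynomial.X : Polynomial ℚ) ^ w i).toLinearMap =
      (Ideal.Quotient.mkₐ ℚ J).toLinearMap := by
    refine (MvPolynomial.basisMonomials σ ℚ).ext fun a => ?_
    have h1 : ψ (Polynomial.monomial (Finsupp.weight w a) 1) = z (Finsupp.weight w a) := by
      simpa using (Polynomial.basisMonomials ℚ).constr_basis ℚ z (Finsupp.weight w a)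
    simp only [coe_basisMonomials, LinearMap.comp_apply, AlgHom.toLinearMap_apply,
      aeval_X_pow_monomial, h1, Ideal.Quotient.mkₐ_eq_mk, hz _ a rfl]
  intro f hf
  have h0 : aeval (fun i => (Polynomial.X : Polynomial ℚ) ^ w i) f = 0 := hf
  have := LinearMap.congr_fun hψ f
  simp only [LinearMap.comp_apply, AlgHom.toLinearMap_apply, h0, map_zero,
    Ideal.Quotient.mkₐ_eq_mk] at this
  exact Ideal.Quotient.eq_zero_iff_mem.1 this.symm

/-- If binomials `x^b - x^(rep b)`, `b ∈ B`, generate the toric ideal and every proper divisor of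
each `x^b` is the only monomial of its weight, then the minimal number of generators is `#B`. -/
theorem isLeast_card_generators (B : Finset (σ →₀ ℕ)) (rep : (σ →₀ ℕ) → (σ →₀ ℕ))
    (hwt : ∀ b ∈ B, Finsupp.weight w (rep b) = Finsupp.weight w b)
    (hrep : ∀ b ∈ B, rep b ∉ B)
    (halone : ∀ b ∈ B, ∀ b' < b, ∀ c, Finsupp.weight w c = Finsupp.weight w b' → c = b')
    (hgen : ∀ J : Ideal (MvPolynomial σ ℚ),
      (∀ b ∈ B, (monomial b 1 : MvPolynomial σ ℚ) - monomial (rep b) 1 ∈ J) →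
      ∀ a c, Finsupp.weight w a = Finsupp.weight w c →
        (monomial a 1 : MvPolynomial σ ℚ) - monomial c 1 ∈ J) :
    IsLeast {k : ℕ | ∃ G : Finset (MvPolynomial σ ℚ), G.card = k ∧
      Ideal.span (G : Set (MvPolynomial σ ℚ)) =
        RingHom.ker (aeval (R := ℚ) fun i => (Polynomial.X : Polynomial ℚ) ^ w i).toRingHom} B.card := by
  classical
  set I := RingHom.ker (aeval (R := ℚ) fun i => (Polynomial.X : Polynomial ℚ) ^ w i).toRingHom with hI
  let Φ : MvPolynomial σ ℚ →ₗ[ℚ] (B → ℚ) := LinearMap.pi fun b => lcoeff ℚ b.1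
  let g : (σ →₀ ℕ) → MvPolynomial σ ℚ := fun b => monomial b 1 - monomial (rep b) 1
  have hΦg : ∀ b : B, Φ (g b) = Pi.single b 1 := by
    intro b
    ext c
    have hc : rep b ≠ c := fun h => hrep b b.2 (h ▸ c.2)
    have hbc : (b : σ →₀ ℕ) = c ↔ c = b := by rw [Subtype.ext_iff, eq_comm]
    simp [Φ, g, coeff_monomial, Pi.single_apply, hc, hbc]
  have hgI : ∀ b ∈ B, g b ∈ I := by
    intro b hb
    change aeval (fun i => (Polynomial.X : Polynomial ℚ) ^ w i) (g b) = 0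
    simp only [g, map_sub, aeval_X_pow_monomial, hwt b hb, sub_self]
  refine ⟨⟨B.image g, Finset.card_image_of_injOn ?_, le_antisymm ?_ ?_⟩, ?_⟩
  · intro b hb c hc hbc
    have := (hΦg ⟨b, hb⟩).symm.trans ((congrArg Φ hbc).trans (hΦg ⟨c, hc⟩))
    by_contra hne
    have := congrFun this ⟨b, hb⟩
    simp [hne] at this
  · rw [Ideal.span_le]
    intro f hf
    obtain ⟨b, hb, rfl⟩ := Finset.mem_image.1 (Finset.mem_coe.1 hf)
    exact hgI b hb
  · exact ker_aeval_X_pow_le (hgen _ fun b hb =>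
      Ideal.subset_span (Finset.mem_coe.2 (Finset.mem_image_of_mem g hb)))
  · rintro k ⟨G, rfl, hG⟩
    have hmem : ∀ f ∈ Ideal.span (G : Set (MvPolynomial σ ℚ)),
        Φ f ∈ Submodule.span ℚ ((G.image Φ : Finset (B → ℚ)) : Set (B → ℚ)) := by
      intro f hf
      induction hf using Submodule.span_induction with
      | mem f hf =>
        exact Submodule.subset_span (Finset.mem_coe.2 (Finset.mem_image_of_mem Φ hf))
      | zero => simp
      | add f h _ _ ihf ihh => rw [map_add]; exact add_mem ihf ihh
      | smul p f hf ih =>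
        have hf' : aeval (fun i => (Polynomial.X : Polynomial ℚ) ^ w i) f = 0 := by
          have : f ∈ I := hG ▸ hf
          exact this
        have : Φ (p • f) = coeff 0 p • Φ f := by
          ext b
          exact coeff_mul_eq_of_forall_lt fun b' hb' =>
            coeff_eq_zero_of_aeval_X_pow_eq_zero hf' (halone b b.2 b' hb')
        rw [this]
        exact Submodule.smul_mem _ _ ih
    have htop : Submodule.span ℚ ((G.image Φ : Finset (B → ℚ)) : Set (B → ℚ)) = ⊤ := by
      rw [eq_top_iff, ← (Pi.basisFun ℚ B).span_eq, Submodule.span_le]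
      rintro _ ⟨b, rfl⟩
      rw [Pi.basisFun_apply, ← hΦg b]
      exact hmem _ (hG ▸ hgI b b.2)
    have := finrank_span_finset_le_card (R := ℚ) (G.image Φ)
    rw [Set.finrank, htop, finrank_top, Module.finrank_fintype_fun_eq_card,
      Fintype.card_coe] at this
    exact this.trans Finset.card_image_le

end BinomialGenerators

section MinimalGenerators

variable {e n : ℕ}

/-- Pairs of nonzero valid indices. -/
def sallyPairs (e n : ℕ) : Finset (Multiset ℕ) :=
  (Finset.range e \ {0, 1, n}).sym2.image Sym2.toMultiset

theorem mem_sallyPairs {s : Multiset ℕ} :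
    s ∈ sallyPairs e n ↔ s.card = 2 ∧ ∀ x ∈ s, x ≠ 0 ∧ SallyValid e n x := by
  unfold sallyPairs SallyValid
  simp only [Finset.mem_image, Finset.mem_sym2_iff]
  have hA : ∀ x, x ∈ Finset.range e \ {0, 1, n} ↔ x ≠ 0 ∧ x < e ∧ x ≠ 1 ∧ x ≠ n := by
    intro x
    simp
    omega
  simp only [hA]
  constructor
  · rintro ⟨z, h, rfl⟩
    exact ⟨z.card_toMultiset, fun x hx => h x (Sym2.mem_toMultiset.1 hx)⟩
  · rintro ⟨hc, h⟩
    obtain ⟨i, j, rfl⟩ := Multiset.card_eq_two.1 hc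
    exact ⟨s(i, j), fun x hx => h x (by simpa using hx), rfl⟩

theorem card_sallyPairs (he : 10 ≤ e) (hn2 : 2 ≤ n) (hne : n ≤ e - 2) :
    (sallyPairs e n).card = (e - 2).choose 2 := by
  have h : (Finset.range e \ {0, 1, n}).card = e - 3 := by
    rw [Finset.card_sdiff_of_subset, Finset.card_range, Finset.card_insert_of_notMem,
      Finset.card_pair]
    · omega
    · simp; omega
    · intro x; simp; omega
  rw [sallyPairs, Finset.card_image_of_injective, Finset.card_sym2, h]
  · congr 1; omega
  · exact fun z z' hz => Sym2.ext fun x => by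
      rw [← Sym2.mem_toMultiset, ← Sym2.mem_toMultiset, hz]

/-- The two pairs of nonzero indices which are chosen factorizations. -/
def sallyBasePairs (e n : ℕ) : Finset (Multiset ℕ) :=
  {sallyRep e n (e + 1), sallyRep e n (if 4 ≤ n then n else e + n)}

theorem sallyBasePairs_subset (he : 10 ≤ e) (hn2 : 2 ≤ n) (hne : n ≤ e - 2) :
    sallyBasePairs e n ⊆ sallyPairs e n := by
  intro s hs
  rw [mem_sallyPairs]
  unfold sallyBasePairs at hs
  rw [Finset.mem_insert, Finset.mem_singleton] at hs
  unfold SallyValid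
  obtain rfl | rfl := hs
  · rw [sallyRep, if_neg (by omega), if_pos rfl]
    split_ifs <;> simp <;> omega
  · by_cases h4 : 4 ≤ n
    · rw [if_pos h4, sallyRep, if_pos (by omega), if_pos rfl]
      simp; omega
    · rw [if_neg h4, sallyRep, if_neg (by omega), if_neg (by omega), if_pos rfl]
      split_ifs <;> simp <;> omega

theorem card_sallyBasePairs (he : 10 ≤ e) (hn2 : 2 ≤ n) (hne : n ≤ e - 2) :
    (sallyBasePairs e n).card = 2 := by
  refine Finset.card_pair fun h => ?_
  have := congrArg (sallyWt e) h
  rw [sallyWt_sallyRep he hn2, sallyWt_sallyRep he hn2] at this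
  split_ifs at this <;> omega

/-- The leading factorizations of the minimal binomial generators. -/
def sallyLeads (e n : ℕ) : Finset (Multiset ℕ) :=
  (sallyPairs e n \ sallyBasePairs e n) ∪ (if n = 4 then {{2, 2, 2}} else ∅)

theorem mem_sallyLeads {s : Multiset ℕ} :
    s ∈ sallyLeads e n ↔
      (s ∈ sallyPairs e n ∧ s ∉ sallyBasePairs e n) ∨ (n = 4 ∧ s = {2, 2, 2}) := by
  unfold sallyLeads
  split_ifs with h <;> simp [h, or_comm]

theorem card_sallyLeads (he : 10 ≤ e) (hn2 : 2 ≤ n) (hne : n ≤ e - 2) :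
    (sallyLeads e n).card =
      if n = 4 then (e - 2).choose 2 - 1 else (e - 2).choose 2 - 2 := by
  have h : (sallyPairs e n \ sallyBasePairs e n).card = (e - 2).choose 2 - 2 := by
    rw [Finset.card_sdiff_of_subset (sallyBasePairs_subset he hn2 hne),
      card_sallyPairs he hn2 hne, card_sallyBasePairs he hn2 hne]
  have h2 : 2 ≤ (e - 2).choose 2 := by
    rw [← card_sallyPairs he hn2 hne, ← card_sallyBasePairs he hn2 hne]
    exact Finset.card_le_card (sallyBasePairs_subset he hn2 hne)
  unfold sallyLeads
  split_ifs
  · rw [Finset.card_union_of_disjoint, h, Finset.card_singleton]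
    · omega
    · rw [Finset.disjoint_singleton_right, Finset.mem_sdiff, mem_sallyPairs]
      simp
  · rw [Finset.union_empty, h]

theorem zero_mem_or_sallyRep_mem (hn2 : 2 ≤ n) (s : ℕ) (hs : s = n → 4 ≤ n) :
    0 ∈ sallyRep e n s ∨ sallyRep e n s ∈ sallyBasePairs e n := by
  unfold sallyBasePairs
  rw [Finset.mem_insert, Finset.mem_singleton]
  by_cases h1 : s = e + 1
  · exact Or.inr (Or.inl (by rw [h1]))
  by_cases h2 : s = if 4 ≤ n then n else e + n
  · exact Or.inr (Or.inr (by rw [← h2]))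
  · left
    unfold sallyRep
    split_ifs at h2 ⊢ <;> first | omega | simp

theorem sallyRep_notMem_sallyLeads (he : 10 ≤ e) (hn2 : 2 ≤ n) (hne : n ≤ e - 2)
    (s : ℕ) (hs : s = n → 4 ≤ n) : sallyRep e n s ∉ sallyLeads e n := by
  rw [mem_sallyLeads, mem_sallyPairs]
  obtain h | h := zero_mem_or_sallyRep_mem (e := e) hn2 s hs
  · rintro (⟨⟨-, h0⟩, -⟩ | ⟨-, h0⟩)
    · exact (h0 0 h).1 rfl
    · rw [h0] at h; simp at h
  · rintro (⟨-, h0⟩ | ⟨-, h0⟩)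
    · exact h0 h
    · have := (mem_sallyPairs.1 (sallyBasePairs_subset he hn2 hne h)).1
      rw [h0] at this
      simp at this

theorem exists_sallyWt_of_mem_sallyLeads (he : 10 ≤ e) (hn2 : 2 ≤ n) (hne : n ≤ e - 2) {s : Multiset ℕ}
    (hs : s ∈ sallyLeads e n) :
    ∃ t, sallyWt e s = 2 * e + t ∧ (t = n → 4 ≤ n) ∧ ∀ x ∈ sallyRep e n t, SallyValid e n x := by
  obtain ⟨h, -⟩ | ⟨rfl, rfl⟩ := mem_sallyLeads.1 hs
  · rw [mem_sallyPairs] at h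
    obtain ⟨i, j, rfl⟩ := Multiset.card_eq_two.1 h.1
    have hij := h.2
    simp at hij
    unfold SallyValid at *
    refine ⟨i + j, by simp; omega, by omega, ?_⟩
    unfold sallyRep
    split_ifs <;> simp <;> omega
  · refine ⟨e + 6, by simp; omega, by omega, ?_⟩
    rw [sallyRep, if_neg (by omega), if_neg (by omega), if_neg (by omega)]
    unfold SallyValid
    simp; omega

theorem valid_of_mem_sallyLeads (he : 10 ≤ e) {s : Multiset ℕ}
    (hs : s ∈ sallyLeads e n) : ∀ x ∈ s, SallyValid e n x := by
  obtain ⟨h, -⟩ | ⟨rfl, rfl⟩ := mem_sallyLeads.1 hs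
  · exact fun x hx => ((mem_sallyPairs.1 h).2 x hx).2
  · unfold SallyValid
    simp; omega

theorem eq_of_lt_mem_sallyLeads (he : 10 ≤ e) {s t u : Multiset ℕ}
    (hs : s ∈ sallyLeads e n) (hts : t < s) (hu : ∀ x ∈ u, SallyValid e n x)
    (hut : sallyWt e u = sallyWt e t) : u = t := by
  have htv : ∀ x ∈ t, SallyValid e n x := fun x hx =>
    valid_of_mem_sallyLeads he hs x (Multiset.mem_of_le hts.le hx)
  have hcard := Multiset.card_lt_card hts
  by_cases h1 : t.card ≤ 1
  · exact card_le_one_or_of_sallyWt_eq (fun x hx => (htv x hx).1) (fun x hx => (hu x hx).1)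
      hut.symm h1
  by_cases h1' : u.card ≤ 1
  · exact (card_le_one_or_of_sallyWt_eq (fun x hx => (hu x hx).1) (fun x hx => (htv x hx).1)
      hut h1').symm
  obtain ⟨h, -⟩ | ⟨rfl, rfl⟩ := mem_sallyLeads.1 hs
  · rw [mem_sallyPairs] at h
    omega
  · have hc3 : Multiset.card ({2, 2, 2} : Multiset ℕ) = 3 := rfl
    have ht2 : t = {2, 2} := by
      have : t = Multiset.replicate t.card 2 := Multiset.eq_replicate_card.2 fun x hx => by
        simpa using Multiset.mem_of_le hts.le hx
      rw [this, show t.card = 2 by omega]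
      rfl
    subst ht2
    have hcu := card_mul_le_sallyWt (e := e) u
    have hu2 : u.card = 2 := by
      by_contra h
      have : e * 3 ≤ e * u.card := Nat.mul_le_mul_left _ (by omega)
      simp at hut
      omega
    obtain ⟨i, j, rfl⟩ := Multiset.card_eq_two.1 hu2
    unfold SallyValid at hu
    simp at hu hut
    obtain ⟨rfl, rfl⟩ : i = 2 ∧ j = 2 := by omega
    rfl

theorem mul_eq_of_sallyLeads {M : Type*} [CommMonoid M] {y : ℕ → M} (he : 10 ≤ e) (hn2 : 2 ≤ n)
    (hy : ∀ s ∈ sallyLeads e n, ∀ t, sallyWt e s = 2 * e + t →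
      (s.map y).prod = ((sallyRep e n t).map y).prod)
    (i j : ℕ) (hi : SallyValid e n i) (hj : SallyValid e n j) :
    y i * y j = ((sallyRep e n (i + j)).map y).prod := by
  have hij : ((({i, j} : Multiset ℕ)).map y).prod = y i * y j := by simp
  by_cases hi0 : i = 0
  · subst hi0
    unfold SallyValid at hj
    rw [zero_add, sallyRep, if_pos hj.1, if_neg hj.2.2]; simp
  by_cases hj0 : j = 0
  · subst hj0
    unfold SallyValid at hi
    rw [add_zero, sallyRep, if_pos hi.1, if_neg hi.2.2]; simp [mul_comm]
  by_cases hb : ({i, j} : Multiset ℕ) ∈ sallyBasePairs e n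
  · unfold sallyBasePairs at hb
    rw [Finset.mem_insert, Finset.mem_singleton] at hb
    obtain ⟨t, ht⟩ : ∃ t, ({i, j} : Multiset ℕ) = sallyRep e n t := by
      obtain hb | hb := hb <;> exact ⟨_, hb⟩
    have htw := congrArg (sallyWt e) ht
    rw [sallyWt_sallyRep he hn2] at htw
    obtain rfl : t = i + j := by simp at htw; omega
    rw [← ht, hij]
  · rw [← hij]
    refine hy _ (mem_sallyLeads.2 (Or.inl ⟨mem_sallyPairs.2 ⟨rfl, ?_⟩, hb⟩)) _ (by simp; omega)
    simp [hi0, hj0, hi, hj]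

/-- The indices of a monomial, with multiplicity. -/
noncomputable def sallyMultiset (e n : ℕ) (a : SallyIdx e 1 n →₀ ℕ) : Multiset ℕ :=
  (Finsupp.toMultiset a).map Subtype.val

theorem sallyMultiset_injective : Function.Injective (sallyMultiset e n) := by
  classical
  intro a b h
  have := Multiset.map_injective Subtype.val_injective h
  rw [← Finsupp.toMultiset_toFinsupp a, this, Finsupp.toMultiset_toFinsupp]

theorem sallyWt_sallyMultiset (a : SallyIdx e 1 n →₀ ℕ) :
    sallyWt e (sallyMultiset e n a) =
      Finsupp.weight (fun i : SallyIdx e 1 n => e + i.1) a := by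
  unfold sallyMultiset
  induction a using Finsupp.induction_linear with
  | zero => simp
  | add a b ha hb => simp [ha, hb]
  | single i c => simp [sallyWt, Finsupp.weight_single, Multiset.map_nsmul, Multiset.sum_nsmul]

theorem valid_of_mem_sallyMultiset (a : SallyIdx e 1 n →₀ ℕ) :
    ∀ x ∈ sallyMultiset e n a, SallyValid e n x := by
  intro x hx
  obtain ⟨i, -, rfl⟩ := Multiset.mem_map.1 hx
  exact i.2

theorem exists_sallyMultiset_eq {s : Multiset ℕ} (hs : ∀ x ∈ s, SallyValid e n x) :
    ∃ a, sallyMultiset e n a = s := by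
  classical
  induction s using Multiset.induction with
  | empty => exact ⟨0, by simp [sallyMultiset]⟩
  | cons i s ih =>
    obtain ⟨a, rfl⟩ := ih fun x hx => hs x (Multiset.mem_cons_of_mem hx)
    exact ⟨Finsupp.single ⟨i, hs i (Multiset.mem_cons_self _ _)⟩ 1 + a, by
      simp [sallyMultiset]⟩

theorem mk_monomial_eq_prod (J : Ideal (MvPolynomial (SallyIdx e 1 n) ℚ))
    (a : SallyIdx e 1 n →₀ ℕ) :
    Ideal.Quotient.mk J (monomial a 1) =
      ((sallyMultiset e n a).map fun i => Ideal.Quotient.mk J (sX e 1 n i)).prod := by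
  unfold sallyMultiset
  induction a using Finsupp.induction_linear with
  | zero => simp
  | add a b ha hb =>
    rw [← one_mul (1 : ℚ), ← monomial_mul, map_mul, ha, hb]
    simp
  | single i c =>
    have : sX e 1 n i.1 = X i := dif_pos i.2
    simp [Multiset.map_nsmul, Multiset.prod_nsmul, this, ← X_pow_eq_monomial]

end MinimalGenerators

theorem stmt6 (e n : ℕ) (he : 10 ≤ e) (hn2 : 2 ≤ n) (hne : n ≤ e - 2) :
    IsLeast {k : ℕ | ∃ G : Finset (MvPolynomial (SallyIdx e 1 n) ℚ),
        G.card = k ∧ Ideal.span (G : Set (MvPolynomial (SallyIdx e 1 n) ℚ)) = sallyIdeal e 1 n}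
      (if n = 4 then Nat.choose (e-2) 2 - 1 else Nat.choose (e-2) 2 - 2) := by
  classical
  let dec := sallyMultiset e n
  let enc := Function.invFun dec
  have enc_dec : ∀ a, enc (dec a) = a := Function.leftInverse_invFun sallyMultiset_injective
  have dec_enc : ∀ s, (∀ x ∈ s, SallyValid e n x) → dec (enc s) = s := fun s hs =>
    Function.invFun_eq (exists_sallyMultiset_eq hs)
  have dec_leads : ∀ s ∈ sallyLeads e n, dec (enc s) = s := fun s hs =>
    dec_enc s (valid_of_mem_sallyLeads he hs)
  have hcard : ((sallyLeads e n).image enc).card = (sallyLeads e n).card :=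
    Finset.card_image_of_injOn fun s hs t ht hst => by
      rw [← dec_leads s hs, ← dec_leads t ht, hst]
  have mem_iff : ∀ a, a ∈ (sallyLeads e n).image enc ↔ dec a ∈ sallyLeads e n := by
    intro a
    rw [Finset.mem_image]
    constructor
    · rintro ⟨s, hs, rfl⟩
      rwa [dec_leads s hs]
    · exact fun h => ⟨_, h, enc_dec a⟩
  rw [← card_sallyLeads he hn2 hne, ← hcard]
  let rep : (SallyIdx e 1 n →₀ ℕ) → (SallyIdx e 1 n →₀ ℕ) := fun a =>
    enc (sallyRep e n (sallyWt e (dec a) - 2 * e))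
  have dec_rep : ∀ a, dec a ∈ sallyLeads e n → ∃ t, (t = n → 4 ≤ n) ∧
      sallyWt e (dec a) = 2 * e + t ∧ dec (rep a) = sallyRep e n t := by
    intro a ha
    obtain ⟨t, ht, htn, htv⟩ := exists_sallyWt_of_mem_sallyLeads he hn2 hne ha
    refine ⟨t, htn, ht, ?_⟩
    simp only [rep, ht, Nat.add_sub_cancel_left]
    exact dec_enc _ htv
  refine isLeast_card_generators (w := fun i : SallyIdx e 1 n => e + i.1) _ rep ?_ ?_ ?_ ?_
  · intro b hb
    obtain ⟨t, -, ht, hd⟩ := dec_rep b ((mem_iff b).1 hb)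
    rw [← sallyWt_sallyMultiset, ← sallyWt_sallyMultiset]
    change sallyWt e (dec _) = sallyWt e (dec _)
    rw [hd, ht, sallyWt_sallyRep he hn2]
  · intro b hb
    obtain ⟨t, htn, -, hd⟩ := dec_rep b ((mem_iff b).1 hb)
    rw [mem_iff, hd]
    exact sallyRep_notMem_sallyLeads he hn2 hne t htn
  · intro b hb b' hb' c hc
    rw [← sallyWt_sallyMultiset, ← sallyWt_sallyMultiset] at hc
    refine sallyMultiset_injective (eq_of_lt_mem_sallyLeads he ((mem_iff b).1 hb)
      (Multiset.map_strictMono _ (Finsupp.toMultiset_strictMono hb'))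
      (valid_of_mem_sallyMultiset c) hc)
  · intro J hJ a c hac
    have hy : ∀ s ∈ sallyLeads e n, ∀ t, sallyWt e s = 2 * e + t →
        (s.map fun i => Ideal.Quotient.mk J (sX e 1 n i)).prod =
          ((sallyRep e n t).map fun i => Ideal.Quotient.mk J (sX e 1 n i)).prod := by
      intro s hs t ht
      have hs' := dec_leads s hs
      have hs'' := hs
      rw [← hs'] at hs''
      obtain ⟨t', -, ht', hd⟩ := dec_rep _ hs''
      obtain rfl : t' = t := by rw [hs'] at ht'; omega
      rw [← hd, ← hs', ← mk_monomial_eq_prod, ← mk_monomial_eq_prod, hs']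
      exact Ideal.Quotient.eq.2 (hJ _ ((mem_iff _).2 hs''))
    refine Ideal.Quotient.eq.1 ?_
    rw [mk_monomial_eq_prod, mk_monomial_eq_prod]
    refine prod_eq_prod_of_sallyWt_eq he hn2 hne (mul_eq_of_sallyLeads he hn2 hy) ?_
      (valid_of_mem_sallyMultiset a) (valid_of_mem_sallyMultiset c)
      (by rw [sallyWt_sallyMultiset, sallyWt_sallyMultiset, hac])
    rintro rfl
    have := hy {2, 2, 2} (mem_sallyLeads.2 (Or.inr ⟨rfl, rfl⟩)) (e + 6) (by simp; omega)
    rw [sallyRep, if_neg (by omega), if_neg (by omega), if_neg (by omega)] at this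
    simpa using this
end

section
/- Let e ≥ 4 and 1 ≤ m < n ≤ e−2 be integers. The numerical semigroup S(e,m,n) is symmetric if and only if (m,n) = (2,3) or (e,m,n) = (4,1,2). (By Kunz's theorem this is equivalent to the statement of the paper: the semigroup ring K[S(e,m,n)] is Gorenstein if and only if (m,n) = (2,3) or (e,m,n) = (4,1,2).) -/
/-- The numerical semigroup `S(e,m,n)`, i.e. the additive submonoid of `ℕ` generated by
`{e, e+1, …, 2e−1} \ {e+m, e+n}`. -/
def sallySemigroup (e m n : ℕ) : AddSubmonoid ℕ :=
  AddSubmonoid.closure {k : ℕ | e ≤ k ∧ k ≤ 2 * e - 1 ∧ k ≠ e + m ∧ k ≠ e + n}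

theorem mem_sallySemigroup_of_generator {e m n k : ℕ} (h₁ : e ≤ k) (h₂ : k ≤ 2 * e - 1)
    (h₃ : k ≠ e + m) (h₄ : k ≠ e + n) : k ∈ sallySemigroup e m n :=
  AddSubmonoid.subset_closure ⟨h₁, h₂, h₃, h₄⟩

/-- An element below `3e` is a sum of at most two generators. -/
theorem sallySemigroup_cases {e m n k : ℕ} (hk : k ∈ sallySemigroup e m n) :
    k = 0 ∨ (e ≤ k ∧ k ≤ 2 * e - 1 ∧ k ≠ e + m ∧ k ≠ e + n) ∨
      (∃ a b, (e ≤ a ∧ a ≤ 2 * e - 1 ∧ a ≠ e + m ∧ a ≠ e + n) ∧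
        (e ≤ b ∧ b ≤ 2 * e - 1 ∧ b ≠ e + m ∧ b ≠ e + n) ∧ k = a + b) ∨ 3 * e ≤ k := by
  induction hk using AddSubmonoid.closure_induction with
  | mem x hx => exact Or.inr (Or.inl hx)
  | zero => exact Or.inl rfl
  | add x y _ _ hx hy =>
    rcases hx with rfl | hx | ⟨a, b, ha, hb, rfl⟩ | hx
    · simpa using hy
    · rcases hy with rfl | hy | ⟨c, d, hc, hd, rfl⟩ | hy
      · exact Or.inr (Or.inl hx)
      · exact Or.inr (Or.inr (Or.inl ⟨x, y, hx, hy, rfl⟩))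
      · right; right; right; omega
      · right; right; right; omega
    · rcases hy with rfl | hy | ⟨c, d, hc, hd, rfl⟩ | hy
      · exact Or.inr (Or.inr (Or.inl ⟨a, b, ha, hb, rfl⟩))
      · right; right; right; omega
      · right; right; right; omega
      · right; right; right; omega
    · right; right; right; omega

/-- Adding multiples of `e` to the generators reaches every residue other than `m` and `n`. -/
theorem mem_sallySemigroup_of_mod {e m n x : ℕ} (he : 0 < e) (hm : 1 ≤ m) (hn : 1 ≤ n)
    (hx : e ≤ x) (h₁ : x % e ≠ m) (h₂ : x % e ≠ n) : x ∈ sallySemigroup e m n := by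
  induction x using Nat.strong_induction_on with
  | _ x ih =>
    by_cases h : x < 2 * e
    · have hmod : x % e = x - e := by
        rw [Nat.mod_eq_sub_mod hx, Nat.mod_eq_of_lt (by omega)]
      exact mem_sallySemigroup_of_generator hx (by omega) (by omega) (by omega)
    · have hmod : x % e = (x - e) % e := Nat.mod_eq_sub_mod hx
      have hrec := ih (x - e) (by omega) (by omega) (by omega) (by omega)
      have hgen : e ∈ sallySemigroup e m n :=
        mem_sallySemigroup_of_generator le_rfl (by omega) (by omega) (by omega)
      have hsum := add_mem hrec hgen
      rwa [Nat.sub_add_cancel hx] at hsum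

/-- One of the decompositions `s = 0 + s = 1 + (s - 1) = 2 + (s - 2)` avoids `m` and `n`. -/
theorem two_mul_add_mem_sallySemigroup {e m n s : ℕ} (hm : 1 ≤ m) (hmn : m < n)
    (hs : 4 ≤ s) (hse : s < e) : 2 * e + s ∈ sallySemigroup e m n := by
  have key : ∀ a, a ≤ s → a ≠ m → a ≠ n → s - a ≠ m → s - a ≠ n →
      2 * e + s ∈ sallySemigroup e m n := by
    intro a ha h₁ h₂ h₃ h₄
    have hsum := add_mem
      (mem_sallySemigroup_of_generator (e := e) (m := m) (n := n) (k := e + a)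
        (by omega) (by omega) (by omega) (by omega))
      (mem_sallySemigroup_of_generator (e := e) (m := m) (n := n) (k := e + (s - a))
        (by omega) (by omega) (by omega) (by omega))
    rwa [show e + a + (e + (s - a)) = 2 * e + s by omega] at hsum
  by_cases h₀ : s = m ∨ s = n
  · by_cases h₁ : 1 = m ∨ 1 = n ∨ s - 1 = m ∨ s - 1 = n
    · exact key 2 (by omega) (by omega) (by omega) (by omega) (by omega)
    · exact key 1 (by omega) (by omega) (by omega) (by omega) (by omega)
  · exact key 0 (by omega) (by omega) (by omega) (by omega) (by omega)

/-- For `e ≥ 5`, every gap is below `3e`. -/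
theorem lt_three_mul_of_notMem_sallySemigroup {e m n F : ℕ} (he : 5 ≤ e) (hm : 1 ≤ m) (hmn : m < n)
    (hn : n ≤ e - 2) (hF : F ∉ sallySemigroup e m n) : F < 3 * e := by
  by_contra! h
  have key : ∀ c, c < e → c ≠ m → c ≠ n →
      (F - e - c) % e = m ∨ (F - e - c) % e = n := by
    intro c hc h₁ h₂
    by_contra! h₃
    have hsum := add_mem
      (mem_sallySemigroup_of_mod (by omega) hm (by omega) (by omega) h₃.1 h₃.2)
      (mem_sallySemigroup_of_generator (e := e) (m := m) (n := n) (k := e + c)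
        (by omega) (by omega) (by omega) (by omega))
    rw [show F - e - c + (e + c) = F by omega] at hsum
    exact hF hsum
  have hr : F % e < e := Nat.mod_lt _ (by omega)
  obtain ⟨q, r, hq, rfl⟩ : ∃ q r, r < e ∧ F = e * q + r :=
    ⟨F / e, F % e, hr, (Nat.div_add_mod F e).symm⟩
  obtain ⟨p, rfl⟩ : ∃ p, q = p + 2 := by
    refine ⟨q - 2, ?_⟩
    have : 2 ≤ q := by
      by_contra! hlt
      have : e * q ≤ e * 1 := Nat.mul_le_mul_left e (by omega)
      omega
    omega
  have hlow : ∀ c, c ≤ r → (e * (p + 2) + r - e - c) % e = r - c := by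
    intro c hc
    rw [show e * (p + 2) + r - e - c = (r - c) + e * (p + 1) by
      rw [show e * (p + 2) = e * (p + 1) + e by ring]; omega]
    rw [Nat.add_mul_mod_self_left, Nat.mod_eq_of_lt (by omega)]
  have hhigh : ∀ c, r < c → c < e → (e * (p + 2) + r - e - c) % e = e + r - c := by
    intro c hc hce
    rw [show e * (p + 2) + r - e - c = (e + r - c) + e * p by
      rw [show e * (p + 2) = e * p + e + e by ring]; omega]
    rw [Nat.add_mul_mod_self_left, Nat.mod_eq_of_lt (by omega)]
  have h₀ := key 0 (by omega) (by omega) (by omega)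
  rw [hlow 0 (by omega)] at h₀
  have h₁ := key (e - 1) (by omega) (by omega) (by omega)
  rw [hhigh (e - 1) (by omega) (by omega)] at h₁
  by_cases hm1 : m = 1
  · have h₃ := key 3 (by omega) (by omega) (by omega)
    rw [hhigh 3 (by omega) (by omega)] at h₃
    omega
  · have h₂ := key 1 (by omega) (by omega) (by omega)
    rw [hlow 1 (by omega)] at h₂
    omega

theorem sallySemigroup_two_three_symmetric {e : ℕ} (he : 5 ≤ e) :
    ∃ F : ℕ, F ∉ sallySemigroup e 2 3 ∧ (∀ k : ℕ, F < k → k ∈ sallySemigroup e 2 3) ∧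
      (∀ k : ℕ, k ∉ sallySemigroup e 2 3 → F - k ∈ sallySemigroup e 2 3) := by
  have gen : ∀ a, a < e → a ≠ 2 → a ≠ 3 → e + a ∈ sallySemigroup e 2 3 := fun a h₁ h₂ h₃ =>
    mem_sallySemigroup_of_generator (by omega) (by omega) (by omega) (by omega)
  have pair : ∀ a b k, a < e → a ≠ 2 → a ≠ 3 → b < e → b ≠ 2 → b ≠ 3 → k = e + a + (e + b) →
      k ∈ sallySemigroup e 2 3 := by
    rintro a b k h₁ h₂ h₃ h₄ h₅ h₆ rfl
    exact add_mem (gen a h₁ h₂ h₃) (gen b h₄ h₅ h₆)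
  have large : ∀ k : ℕ, 2 * e + 3 < k → k ∈ sallySemigroup e 2 3 := by
    intro k
    induction k using Nat.strong_induction_on with
    | _ k ih =>
      intro hk
      by_cases h₁ : k < 3 * e
      · exact pair 0 (k - 2 * e) k (by omega) (by omega) (by omega) (by omega) (by omega)
          (by omega) (by omega)
      by_cases h₂ : k = 3 * e + 1 ∨ k = 3 * e + 2
      · have hsum := add_mem (pair 1 (k - 3 * e - 1) (k - e) (by omega) (by omega) (by omega)
          (by omega) (by omega) (by omega) (by omega)) (gen 0 (by omega) (by omega) (by omega))
        rwa [show k - e + (e + 0) = k by omega] at hsum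
      by_cases h₃ : k ≤ 3 * e + 3
      · exact pair (e - 1) (k - 3 * e + 1) k (by omega) (by omega) (by omega) (by omega)
          (by omega) (by omega) (by omega)
      · have hsum := add_mem (ih (k - e) (by omega) (by omega))
          (gen 0 (by omega) (by omega) (by omega))
        rwa [show k - e + (e + 0) = k by omega] at hsum
  refine ⟨2 * e + 3, ?_, large, ?_⟩
  · intro h
    rcases sallySemigroup_cases h with h | h | ⟨a, b, ha, hb, h⟩ | h <;> omega
  · intro k hk
    have hk0 : k ≠ 0 := fun h => hk (h ▸ zero_mem _)
    have hgen : ¬(e ≤ k ∧ k < 2 * e ∧ k ≠ e + 2 ∧ k ≠ e + 3) := fun h =>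
      hk (mem_sallySemigroup_of_generator h.1 (by omega) h.2.2.1 h.2.2.2)
    have hk3 : ¬2 * e + 3 < k := fun h => hk (large k h)
    have hk₀ : k ≠ 2 * e := fun h => hk (pair 0 0 k (by omega) (by omega) (by omega) (by omega)
      (by omega) (by omega) (by omega))
    have hk₁ : k ≠ 2 * e + 1 := fun h => hk (pair 0 1 k (by omega) (by omega) (by omega)
      (by omega) (by omega) (by omega) (by omega))
    have hk₂ : k ≠ 2 * e + 2 := fun h => hk (pair 1 1 k (by omega) (by omega) (by omega)
      (by omega) (by omega) (by omega) (by omega))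
    by_cases h₁ : k = 2 * e + 3
    · simp [h₁]
    by_cases h₂ : k ≤ 3
    · by_cases h₃ : k = 1
      · exact pair 1 1 _ (by omega) (by omega) (by omega) (by omega) (by omega) (by omega)
          (by omega)
      · exact pair 0 (3 - k) _ (by omega) (by omega) (by omega) (by omega) (by omega) (by omega)
          (by omega)
    · exact mem_sallySemigroup_of_generator (by omega) (by omega) (by omega) (by omega)

theorem sallySemigroup_four_one_two_symmetric :
    ∃ F : ℕ, F ∉ sallySemigroup 4 1 2 ∧ (∀ k : ℕ, F < k → k ∈ sallySemigroup 4 1 2) ∧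
      (∀ k : ℕ, k ∉ sallySemigroup 4 1 2 → F - k ∈ sallySemigroup 4 1 2) := by
  have mem_iff : ∀ k, k ∈ sallySemigroup 4 1 2 ↔ ∃ a b, k = 4 * a + 7 * b := by
    intro k
    constructor
    · intro hk
      induction hk using AddSubmonoid.closure_induction with
      | mem x hx =>
        obtain ⟨h₁, h₂, h₃, h₄⟩ := hx
        obtain rfl | rfl : x = 4 ∨ x = 7 := by omega
        · exact ⟨1, 0, rfl⟩
        · exact ⟨0, 1, rfl⟩
      | zero => exact ⟨0, 0, rfl⟩
      | add x y _ _ hx hy =>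
        obtain ⟨a, b, rfl⟩ := hx
        obtain ⟨c, d, rfl⟩ := hy
        exact ⟨a + c, b + d, by ring⟩
    · rintro ⟨a, b, rfl⟩
      have h₄ : 4 ∈ sallySemigroup 4 1 2 := mem_sallySemigroup_of_generator
        (by norm_num) (by norm_num) (by norm_num) (by norm_num)
      have h₇ : 7 ∈ sallySemigroup 4 1 2 := mem_sallySemigroup_of_generator
        (by norm_num) (by norm_num) (by norm_num) (by norm_num)
      have hsum := add_mem (nsmul_mem h₄ a) (nsmul_mem h₇ b)
      rwa [smul_eq_mul, smul_eq_mul, mul_comm a, mul_comm b] at hsum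
  simp only [mem_iff]
  refine ⟨17, ?_, ?_, ?_⟩
  · rintro ⟨a, b, h⟩
    omega
  · intro k hk
    exact ⟨(k - 7 * (3 * k % 4)) / 4, 3 * k % 4, by omega⟩
  · intro k hk
    by_cases h : 7 * (3 * k % 4) ≤ k
    · exact absurd ⟨(k - 7 * (3 * k % 4)) / 4, 3 * k % 4, by omega⟩ hk
    · have hk17 : k ≤ 17 := by omega
      exact ⟨(17 - k - 7 * (3 * (17 - k) % 4)) / 4, 3 * (17 - k) % 4, by
        interval_cases k <;> omega⟩

theorem stmt7 (e m n : ℕ) (he : 4 ≤ e) (hm : 1 ≤ m) (hmn : m < n) (hn : n ≤ e - 2) :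
    (∃ F : ℕ, F ∉ sallySemigroup e m n ∧ (∀ k : ℕ, F < k → k ∈ sallySemigroup e m n) ∧
        (∀ k : ℕ, k ∉ sallySemigroup e m n → F - k ∈ sallySemigroup e m n))
    ↔ ((m, n) = (2, 3) ∨ (e, m, n) = (4, 1, 2)) := by
  constructor
  · rintro ⟨F, hF, hlarge, hsym⟩
    by_cases he4 : e = 4
    · right
      obtain ⟨rfl, rfl, rfl⟩ : e = 4 ∧ m = 1 ∧ n = 2 := by omega
      rfl
    left
    have gap : ∀ k, 1 ≤ k → k < e → k ∉ sallySemigroup e m n := by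
      intro k h₁ h₂ h
      rcases sallySemigroup_cases h with h | h | ⟨a, b, ha, hb, h⟩ | h <;> omega
    have gapm : e + m ∉ sallySemigroup e m n := by
      intro h
      rcases sallySemigroup_cases h with h | h | ⟨a, b, ha, hb, h⟩ | h <;> omega
    have gapn : e + n ∉ sallySemigroup e m n := by
      intro h
      rcases sallySemigroup_cases h with h | h | ⟨a, b, ha, hb, h⟩ | h <;> omega
    have hF3 : F < 3 * e := lt_three_mul_of_notMem_sallySemigroup (by omega) hm hmn hn hF
    have hFn : e + n ≤ F := by
      by_contra! h
      exact gapn (hlarge _ h)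
    have hFn' : 2 * e + n ≤ F := by
      by_contra! h
      by_cases hz : F = e + n
      · exact gap (F - (e + m)) (by omega) (by omega) (hsym _ gapm)
      · exact gap (F - (e + n)) (by omega) (by omega) (hsym _ gapn)
    have hF4 : F ≤ 2 * e + 3 := by
      by_contra! h
      have hmem := two_mul_add_mem_sallySemigroup (e := e) (s := F - 2 * e) hm hmn
        (by omega) (by omega)
      rw [show 2 * e + (F - 2 * e) = F by omega] at hmem
      exact hF hmem
    have hm2 : m ≠ 1 := by
      intro h1
      have hgap : 2 * e + 1 ∉ sallySemigroup e m n := by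
        intro h
        rcases sallySemigroup_cases h with h | h | ⟨a, b, ha, hb, h⟩ | h <;> omega
      exact gap (F - (2 * e + 1)) (by omega) (by omega) (hsym _ hgap)
    obtain ⟨rfl, rfl⟩ : m = 2 ∧ n = 3 := by omega
    rfl
  · rintro (h | h)
    · simp only [Prod.mk.injEq] at h
      obtain ⟨rfl, rfl⟩ := h
      exact sallySemigroup_two_three_symmetric (by omega)
    · simp only [Prod.mk.injEq] at h
      obtain ⟨rfl, rfl, rfl⟩ := h
      exact sallySemigroup_four_one_two_symmetric
end

section
/- Let e ≥ 5 be an integer. The Frobenius number of the numerical semigroup S(e,1,2) (i.e., the greatest natural number not belonging to S(e,1,2)) equals 2e+2: that is, 2e+2 ∉ S(e,1,2) and every integer k > 2e+2 belongs to S(e,1,2). -/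
theorem mem_sallySemigroup_one_two_of_generator {e k : ℕ}
    (h : k = e ∨ e + 3 ≤ k ∧ k ≤ 2 * e - 1) (he : 1 ≤ e) : k ∈ sallySemigroup e 1 2 :=
  AddSubmonoid.subset_closure (show e ≤ k ∧ k ≤ 2 * e - 1 ∧ k ≠ e + 1 ∧ k ≠ e + 2 by omega)

theorem eq_or_le_of_mem_sallySemigroup_one_two {e k : ℕ} (he : 3 ≤ e)
    (hk : k ∈ sallySemigroup e 1 2) :
    k = 0 ∨ k = e ∨ e + 3 ≤ k ∧ k ≤ 2 * e - 1 ∨ k = 2 * e ∨ 2 * e + 3 ≤ k := by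
  unfold sallySemigroup at hk
  induction hk using AddSubmonoid.closure_induction with
  | mem x hx =>
    obtain ⟨h₁, h₂, h₃, h₄⟩ := hx
    omega
  | zero => exact Or.inl rfl
  | add x y _ _ hx hy => omega

theorem stmt8 (e : ℕ) (he : 5 ≤ e) :
    2 * e + 2 ∉ sallySemigroup e 1 2 ∧
    ∀ k : ℕ, 2 * e + 2 < k → k ∈ sallySemigroup e 1 2 := by
  refine ⟨fun h => ?_, fun k => ?_⟩
  · have := eq_or_le_of_mem_sallySemigroup_one_two (by omega) h
    omega
  have gen {j : ℕ} (h : j = e ∨ e + 3 ≤ j ∧ j ≤ 2 * e - 1) : j ∈ sallySemigroup e 1 2 :=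
    mem_sallySemigroup_one_two_of_generator h (by omega)
  induction k using Nat.strong_induction_on with
  | _ k ih =>
    intro hk
    have sub_e (h : k - e ∈ sallySemigroup e 1 2) : k ∈ sallySemigroup e 1 2 := by
      have := add_mem h (gen (Or.inl rfl))
      rwa [Nat.sub_add_cancel (by omega)] at this
    rcases le_or_gt (3 * e + 3) k with h | h
    · exact sub_e (ih (k - e) (by omega) (by omega))
    rcases lt_trichotomy k (3 * e) with h' | rfl | h'
    · exact sub_e (gen (by omega))
    · apply sub_e
      have := add_mem (gen (Or.inl rfl)) (gen (Or.inl rfl))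
      rwa [show 3 * e - e = e + e by omega]
    · have := add_mem (gen (j := e + 3) (by omega)) (gen (j := k - (e + 3)) (by omega))
      rwa [Nat.add_sub_cancel' (by omega)] at this
end

section
/- Let e ≥ 5 be an integer. The Frobenius number of the numerical semigroup S(e,1,3) (i.e., the greatest natural number not belonging to S(e,1,3)) equals 2e+3: that is, 2e+3 ∉ S(e,1,3) and every integer k > 2e+3 belongs to S(e,1,3). -/
theorem stmt9 (e : ℕ) (he : 5 ≤ e) :
    2 * e + 3 ∉ sallySemigroup e 1 3 ∧
    ∀ k : ℕ, 2 * e + 3 < k → k ∈ sallySemigroup e 1 3 := by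
  constructor
  · intro h
    have key : ∀ k ∈ sallySemigroup e 1 3,
        k = 0 ∨ (e ≤ k ∧ k ≠ e + 1 ∧ k ≠ e + 3 ∧ k ≠ 2 * e + 3) := by
      intro k hk
      induction hk using AddSubmonoid.closure_induction with
      | mem x hx =>
        obtain ⟨h₁, h₂, h₃, h₄⟩ := hx
        omega
      | zero => exact Or.inl rfl
      | add x y _ _ hx hy => omega
    have := key _ h
    omega
  · intro k
    have add_mem_of_eq : ∀ {a b c : ℕ}, a ∈ sallySemigroup e 1 3 → b ∈ sallySemigroup e 1 3 →
        c = a + b → c ∈ sallySemigroup e 1 3 := by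
      rintro a b _ ha hb rfl
      exact add_mem ha hb
    have he₀ : e ∈ sallySemigroup e 1 3 := by
      apply mem_sallySemigroup_of_generator <;> omega
    have he₂ : e + 2 ∈ sallySemigroup e 1 3 := by
      apply mem_sallySemigroup_of_generator <;> omega
    have he₄ : e + 4 ∈ sallySemigroup e 1 3 := by
      apply mem_sallySemigroup_of_generator <;> omega
    have hlast : 2 * e - 1 ∈ sallySemigroup e 1 3 := by
      apply mem_sallySemigroup_of_generator <;> omega
    induction k using Nat.strong_induction_on with
    | _ k ih =>
      intro hk
      by_cases hbig : 3 * e + 3 < k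
      · exact add_mem_of_eq he₀ (ih (k - e) (by omega) (by omega)) (by omega)
      obtain h | h | h | h | h :
          k < 3 * e ∨ k = 3 * e ∨ k = 3 * e + 1 ∨ k = 3 * e + 2 ∨ k = 3 * e + 3 := by omega
      · have hg : k - e ∈ sallySemigroup e 1 3 := by
          apply mem_sallySemigroup_of_generator <;> omega
        exact add_mem_of_eq he₀ hg (by omega)
      · exact add_mem_of_eq he₀ (add_mem he₀ he₀) (by omega)
      · exact add_mem_of_eq he₂ hlast (by omega)
      · exact add_mem_of_eq he₀ (add_mem he₀ he₂) (by omega)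
      · exact add_mem_of_eq he₄ hlast (by omega)
end

section
/- Let e ≥ 6 and 4 ≤ n ≤ e−2 be integers. The Frobenius number of the numerical semigroup S(e,1,n) (i.e., the greatest natural number not belonging to S(e,1,n)) equals 2e+1: that is, 2e+1 ∉ S(e,1,n) and every integer k > 2e+1 belongs to S(e,1,n). -/
theorem eq_zero_or_of_mem_sallySemigroup_one {e n x : ℕ} (he : 2 ≤ e)
    (hx : x ∈ sallySemigroup e 1 n) :
    x = 0 ∨ (e ≤ x ∧ x ≤ 2 * e - 1 ∧ x ≠ e + 1) ∨ (2 * e ≤ x ∧ x ≠ 2 * e + 1) := by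
  unfold sallySemigroup at hx
  induction hx using AddSubmonoid.closure_induction with
  | mem x hx =>
    obtain ⟨h1, h2, h3, -⟩ := hx
    exact Or.inr (Or.inl ⟨h1, h2, h3⟩)
  | zero => exact Or.inl rfl
  | add x y _ _ hx hy => omega

theorem add_mem_sallySemigroup {e m n i : ℕ} (hi : i < e) (him : i ≠ m) (hin : i ≠ n) :
    e + i ∈ sallySemigroup e m n :=
  AddSubmonoid.subset_closure ⟨by omega, by omega, by omega, by omega⟩

theorem mem_sallySemigroup_of_eq_add {e m n i j k : ℕ} (hi : i < e ∧ i ≠ m ∧ i ≠ n)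
    (hj : j < e ∧ j ≠ m ∧ j ≠ n) (hk : k = (e + i) + (e + j)) : k ∈ sallySemigroup e m n :=
  hk ▸ add_mem (add_mem_sallySemigroup hi.1 hi.2.1 hi.2.2)
    (add_mem_sallySemigroup hj.1 hj.2.1 hj.2.2)

theorem stmt10 (e n : ℕ) (he : 6 ≤ e) (hn4 : 4 ≤ n) (hne : n ≤ e - 2) :
    2 * e + 1 ∉ sallySemigroup e 1 n ∧
    ∀ k : ℕ, 2 * e + 1 < k → k ∈ sallySemigroup e 1 n := by
  refine ⟨fun h => ?_, fun k => ?_⟩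
  · have := eq_zero_or_of_mem_sallySemigroup_one (by omega) h
    omega
  induction k using Nat.strong_induction_on with
  | _ k ih =>
    intro hk
    by_cases hlarge : 3 * e + 1 < k
    · have h := add_mem (ih (k - e) (by omega) (by omega))
        (add_mem_sallySemigroup (e := e) (m := 1) (n := n) (i := 0)
          (by omega) (by omega) (by omega))
      rwa [add_zero, Nat.sub_add_cancel (by omega)] at h
    obtain ⟨j, rfl⟩ := Nat.exists_eq_add_of_le (show 2 * e ≤ k by omega)
    by_cases hjn : j = n
    · exact mem_sallySemigroup_of_eq_add (i := 2) (j := j - 2) (by omega) (by omega) (by omega)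
    by_cases hj : j < e
    · exact mem_sallySemigroup_of_eq_add (i := 0) (j := j) (by omega) (by omega) (by omega)
    by_cases hje : j = e + 1
    · exact mem_sallySemigroup_of_eq_add (i := 2) (j := e - 1) (by omega) (by omega) (by omega)
    by_cases hn : n = e - 2
    · exact mem_sallySemigroup_of_eq_add (i := 3) (j := e - 3) (by omega) (by omega) (by omega)
    · exact mem_sallySemigroup_of_eq_add (i := 2) (j := e - 2) (by omega) (by omega) (by omega)
end

section
/- Let e ≥ 5 be an integer and consider (m,n) = (e−4, e−3). Then the ring K[\bar S(e,e−4,e−3)] is not Cohen–Macaulay; formally, the sequence (y, x_{e−1}) of homogeneous linear elements (which is a homogeneous system of parameters of the two-dimensional graded ring K[\bar S(e,e−4,e−3)]) is NOT a regular sequence on K[\bar S(e,e−4,e−3)]: the image of y is a nonzerodivisor, but the image of x_{e−1} is a zerodivisor on K[\bar S(e,e−4,e−3)]/(y). -/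
open MvPolynomial

/-- The variable `x_i` of `R(e,m,n)[y]` (and `0` for an invalid index); the extra
variable `y` is `X none`. -/
noncomputable def bX (e m n : ℕ) (i : ℕ) : MvPolynomial (Option (SallyIdx e m n)) ℚ :=
  if h : i < e ∧ i ≠ m ∧ i ≠ n then MvPolynomial.X (some ⟨i, h⟩) else 0

/-- The `ℚ`-algebra homomorphism `R(e,m,n)[y] → ℚ[t₁,t₂]` sending
`x_i ↦ t₁^{e+i} t₂^{e−1−i}` and `y ↦ t₂^{2e−1}`. -/
noncomputable def barMap (e m n : ℕ) :
    MvPolynomial (Option (SallyIdx e m n)) ℚ →ₐ[ℚ] MvPolynomial (Fin 2) ℚ :=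
  MvPolynomial.aeval (fun i : Option (SallyIdx e m n) =>
    match i with
    | none => (MvPolynomial.X 1 : MvPolynomial (Fin 2) ℚ) ^ (2 * e - 1)
    | some j => (MvPolynomial.X 0 : MvPolynomial (Fin 2) ℚ) ^ (e + j.1) *
        (MvPolynomial.X 1 : MvPolynomial (Fin 2) ℚ) ^ (e - 1 - j.1))

/-- The defining ideal `I_{\bar S(e,m,n)}` of the projective monomial curve. -/
noncomputable def barIdeal (e m n : ℕ) : Ideal (MvPolynomial (Option (SallyIdx e m n)) ℚ) :=
  RingHom.ker (barMap e m n).toRingHom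

/-- The exponent pairs `(a, b)` with `a + b = (2e−1)k` for some `k` such that `b ≥ 4` or `b ≤ k`. It
contains every exponent occurring in the image of `barMap e (e-4) (e-3)`. -/
def exponentSubmonoid (e : ℕ) : AddSubmonoid (Fin 2 →₀ ℕ) where
  carrier := {w | ∃ k, w 0 + w 1 = (2 * e - 1) * k ∧ (4 ≤ w 1 ∨ w 1 ≤ k)}
  zero_mem' := ⟨0, by simp⟩
  add_mem' := by
    rintro a b ⟨k, hk, hk'⟩ ⟨l, hl, hl'⟩
    refine ⟨k + l, ?_, ?_⟩
    · simp only [Finsupp.add_apply, mul_add]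
      omega
    · simp only [Finsupp.add_apply]
      omega

theorem barMap_X_none (e m n : ℕ) :
    barMap e m n (X none) = monomial (Finsupp.single 1 (2 * e - 1)) 1 := by
  simp [barMap, X_pow_eq_monomial]

theorem barMap_X_some (e m n : ℕ) (j : SallyIdx e m n) :
    barMap e m n (X (some j)) =
      monomial (Finsupp.single 0 (e + j.1) + Finsupp.single 1 (e - 1 - j.1)) 1 := by
  simp [barMap, X_pow_eq_monomial, monomial_mul]

theorem barMap_bX {e m n i : ℕ} (h : i < e ∧ i ≠ m ∧ i ≠ n) :
    barMap e m n (bX e m n i) =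
      monomial (Finsupp.single 0 (e + i) + Finsupp.single 1 (e - 1 - i)) 1 := by
  rw [bX, dif_pos h, barMap_X_some]

theorem barMap_X_mem_exponentSubmonoid {e : ℕ} (he : 5 ≤ e)
    (i : Option (SallyIdx e (e - 4) (e - 3))) :
    ∃ v ∈ exponentSubmonoid e, barMap e (e - 4) (e - 3) (X i) = monomial v 1 := by
  rcases i with _ | j
  · refine ⟨_, ⟨1, ?_⟩, barMap_X_none _ _ _⟩
    simp
    omega
  · refine ⟨_, ⟨1, ?_⟩, barMap_X_some _ _ _ j⟩
    have := j.2
    simp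
    omega

theorem mem_exponentSubmonoid_of_coeff_barMap_ne_zero {e : ℕ} (he : 5 ≤ e)
    (p : MvPolynomial (Option (SallyIdx e (e - 4) (e - 3))) ℚ) {w : Fin 2 →₀ ℕ}
    (hw : coeff w (barMap e (e - 4) (e - 3) p) ≠ 0) : w ∈ exponentSubmonoid e := by
  induction p using MvPolynomial.induction_on generalizing w with
  | C a =>
    have h : barMap e (e - 4) (e - 3) (C a) = C a := by simp [barMap, algebraMap_eq]
    rw [h, coeff_C] at hw
    obtain rfl : 0 = w := by
      by_contra h0
      simp [h0] at hw
    exact zero_mem _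
  | add p q hp hq =>
    rw [map_add, coeff_add] at hw
    by_cases h : coeff w (barMap e (e - 4) (e - 3) p) = 0
    · exact hq fun h' => hw (by rw [h, h', add_zero])
    · exact hp h
  | mul_X p i hp =>
    obtain ⟨v, hv, hi⟩ := barMap_X_mem_exponentSubmonoid he i
    rw [map_mul, hi, coeff_mul_monomial'] at hw
    split_ifs at hw with hle
    · rw [← tsub_add_cancel_of_le hle]
      exact add_mem (hp (by simpa using hw)) hv
    · exact absurd rfl hw

theorem not_mem_exponentSubmonoid {e : ℕ} (he : 5 ≤ e) :
    Finsupp.single 0 (4 * e - 5) + Finsupp.single 1 3 ∉ exponentSubmonoid e := by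
  rintro ⟨k, hk, hk'⟩
  simp at hk hk'
  have h : (2 * e - 1) * 3 ≤ (2 * e - 1) * k := Nat.mul_le_mul_left _ hk'
  omega

theorem mk_barIdeal_eq_mk_iff {e m n : ℕ} {p q : MvPolynomial (Option (SallyIdx e m n)) ℚ} :
    Ideal.Quotient.mk (barIdeal e m n) p = Ideal.Quotient.mk (barIdeal e m n) q ↔
      barMap e m n p = barMap e m n q := by
  rw [Ideal.Quotient.eq, barIdeal, RingHom.mem_ker, map_sub, sub_eq_zero]
  rfl

/-- The monomials `x_{e−1} x_0² x_{e−5}` and `y x_{e−2}³` agree on the curve. -/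
theorem barMap_bX_relation {e : ℕ} (he : 5 ≤ e) :
    barMap e (e - 4) (e - 3) (bX e (e - 4) (e - 3) (e - 1) *
        (bX e (e - 4) (e - 3) 0 ^ 2 * bX e (e - 4) (e - 3) (e - 5))) =
      barMap e (e - 4) (e - 3) (X none * bX e (e - 4) (e - 3) (e - 2) ^ 3) := by
  simp only [map_mul, map_pow, barMap_X_none]
  rw [barMap_bX (by omega), barMap_bX (by omega), barMap_bX (by omega), barMap_bX (by omega)]
  simp only [monomial_pow, monomial_mul, one_pow, mul_one]
  refine congrArg (monomial · (1 : ℚ)) ?_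
  ext i
  fin_cases i <;> simp <;> omega

theorem barMap_witness {e : ℕ} (he : 5 ≤ e) :
    barMap e (e - 4) (e - 3) (bX e (e - 4) (e - 3) 0 ^ 2 * bX e (e - 4) (e - 3) (e - 5)) =
      monomial (Finsupp.single 0 (4 * e - 5) + Finsupp.single 1 3) 1 *
        monomial (Finsupp.single 1 (2 * e - 1)) 1 := by
  simp only [map_mul, map_pow]
  rw [barMap_bX (by omega), barMap_bX (by omega)]
  simp only [monomial_pow, monomial_mul, one_pow, mul_one]
  refine congrArg (monomial · (1 : ℚ)) ?_
  ext i
  fin_cases i <;> simp <;> omega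

theorem stmt12 (e : ℕ) (he : 5 ≤ e) :
    -- the image of `y` is a nonzerodivisor on `K[\bar S(e,e−4,e−3)]`
    Ideal.Quotient.mk (barIdeal e (e-4) (e-3)) (MvPolynomial.X none) ∈
      nonZeroDivisors (MvPolynomial (Option (SallyIdx e (e-4) (e-3))) ℚ ⧸ barIdeal e (e-4) (e-3)) ∧
    -- but the image of `x_{e−1}` is a zerodivisor on `K[\bar S(e,e−4,e−3)]/(y)`
    Ideal.Quotient.mk
        (Ideal.span {Ideal.Quotient.mk (barIdeal e (e-4) (e-3)) (MvPolynomial.X none)})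
        (Ideal.Quotient.mk (barIdeal e (e-4) (e-3)) (bX e (e-4) (e-3) (e-1))) ∉
      nonZeroDivisors
        ((MvPolynomial (Option (SallyIdx e (e-4) (e-3))) ℚ ⧸ barIdeal e (e-4) (e-3)) ⧸
          Ideal.span {Ideal.Quotient.mk (barIdeal e (e-4) (e-3)) (MvPolynomial.X none)}) := by
  constructor
  · have : (barIdeal e (e-4) (e-3)).IsPrime := RingHom.ker_isPrime _
    refine mem_nonZeroDivisors_of_ne_zero fun h => ?_
    rw [← map_zero (Ideal.Quotient.mk (barIdeal e (e-4) (e-3))), mk_barIdeal_eq_mk_iff,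
      barMap_X_none, map_zero, monomial_eq_zero] at h
    exact one_ne_zero h
  · intro h
    set I := barIdeal e (e-4) (e-3)
    set f := bX e (e-4) (e-3) 0 ^ 2 * bX e (e-4) (e-3) (e-5) with hf
    have hzero := (mem_nonZeroDivisors_iff.mp h).1
      (Ideal.Quotient.mk _ (Ideal.Quotient.mk I f)) (by
        rw [← map_mul, ← map_mul, Ideal.Quotient.eq_zero_iff_mem, Ideal.mem_span_singleton,
          mk_barIdeal_eq_mk_iff.mpr (barMap_bX_relation he), map_mul]
        exact dvd_mul_right _ _)
    rw [Ideal.Quotient.eq_zero_iff_mem, Ideal.mem_span_singleton'] at hzero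
    obtain ⟨g', hg⟩ := hzero
    obtain ⟨g, rfl⟩ := Ideal.Quotient.mk_surjective g'
    rw [← map_mul, mk_barIdeal_eq_mk_iff, map_mul, barMap_X_none, hf, barMap_witness he] at hg
    have hmon : (monomial (Finsupp.single 1 (2 * e - 1)) 1 : MvPolynomial (Fin 2) ℚ) ≠ 0 := by
      simp [monomial_eq_zero]
    refine not_mem_exponentSubmonoid he (mem_exponentSubmonoid_of_coeff_barMap_ne_zero he g ?_)
    rw [mul_right_cancel₀ hmon hg, coeff_monomial, if_pos rfl]
    exact one_ne_zero
end

section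
/- Let e ≥ 10 and 1 ≤ m < n ≤ e−2 be integers with (m,n) ≠ (e−4, e−3), and let A = K[\bar S(e,m,n)]/(y, x_{e−1}) with its induced standard grading. Then A is a finite-dimensional graded K-algebra with dim_K A = 2e−1, dim_K A_0 = 1, dim_K A_1 = e−3, A_d = 0 for all d ≥ 4 (hence dim_K A_2 + dim_K A_3 = e+1), and the Hilbert function of A is not symmetric: letting s = max{d : A_d ≠ 0}, there exists an index i with dim_K A_i ≠ dim_K A_{s−i}. (Consequently, by Stanley's symmetry theorem for Gorenstein Artinian graded algebras, K[\bar S(e,m,n)] is not Gorenstein for e ≥ 10.) -/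
open MvPolynomial

/-- The ideal `I_{\bar S(e,m,n)} + (y, x_{e−1})` of `R(e,m,n)[y]`. -/
noncomputable def artinIdeal (e m n : ℕ) : Ideal (MvPolynomial (Option (SallyIdx e m n)) ℚ) :=
  barIdeal e m n + Ideal.span {MvPolynomial.X none, bX e m n (e-1)}

/-- The degree-`d` graded piece of `A = K[\bar S(e,m,n)]/(y, x_{e−1})`, realized as the image of
the space of homogeneous polynomials of degree `d` in `R(e,m,n)[y]/(I_{\bar S(e,m,n)} + (y, x_{e−1}))`. -/
noncomputable def artinPiece (e m n d : ℕ) :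
    Submodule ℚ (MvPolynomial (Option (SallyIdx e m n)) ℚ ⧸ artinIdeal e m n) :=
  Submodule.map (Ideal.Quotient.mkₐ ℚ (artinIdeal e m n)).toLinearMap
    (MvPolynomial.homogeneousSubmodule (Option (SallyIdx e m n)) ℚ d)

/-- The exponent of `t₁` in the image of a variable under `barMap`. -/
def expFst (e m n : ℕ) : Option (SallyIdx e m n) → ℕ
  | none => 0
  | some j => e + j.1

/-- The exponent of `t₂` in the image of a variable under `barMap`. -/
def expSnd (e m n : ℕ) : Option (SallyIdx e m n) → ℕ
  | none => 2 * e - 1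
  | some j => e - 1 - j.1

/-- The basis element of `A` in the residue class `r` modulo `2e-1` is represented by monomials with
`t₁`-exponent `r + xShift e m n r * (2e-1)`. -/
def xShift (e m n r : ℕ) : ℕ :=
  if r = 0 then 0
  else if e ≤ r then (if r = e + m ∨ r = e + n then 1 else 0)
  else if (r = 2 ∧ m = 1) ∨ (r = 3 ∧ m = 1 ∧ n = 2) ∨ (r = 4 ∧ n = 3 ∧ (m = 1 ∨ m = 2)) then 2
  else 1

/-- The basis element of `A` in the residue class `r` modulo `2e-1` has degree
`xShift e m n r + yShift e m n r`. -/
def yShift (e m n r : ℕ) : ℕ :=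
  if r = 0 then 0
  else if n = e - 2 ∧ (r = 2 * e - 2 ∨ (r = 2 * e - 3 ∧ m = e - 3) ∨
    (r = 2 * e - 4 ∧ m = e - 4)) then 2
  else 1

/-- The degree of the basis element of `A` in the residue class `r`. -/
def aperyDegree (e m n r : ℕ) : ℕ := xShift e m n r + yShift e m n r

/-- Adding a generator `e + i` to the residue class `r` when the sum does not exceed `2e-1`. -/
lemma shift_le_of_lt {e m n r i : ℕ} (he : 10 ≤ e) (hmn : m < n)
    (hi : i < e ∧ i ≠ m ∧ i ≠ n) (h : r + (e + i) < 2 * e - 1) :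
    xShift e m n (r + (e + i)) ≤ xShift e m n r ∧
      yShift e m n (r + (e + i)) ≤ yShift e m n r + 1 := by
  unfold xShift yShift
  constructor <;> split_ifs <;> omega

/-- Adding a generator `e + i` to the residue class `r` when the sum wraps around `2e-1`. -/
lemma shift_le_of_ge {e m n r s i : ℕ} (he : 10 ≤ e) (hmn : m < n) (hn : n ≤ e - 2)
    (hi : i < e ∧ i ≠ m ∧ i ≠ n) (hr : r < 2 * e - 1) (h : r + (e + i) = s + (2 * e - 1)) :
    xShift e m n s ≤ xShift e m n r + 1 ∧ yShift e m n s ≤ yShift e m n r := by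
  unfold xShift yShift
  constructor <;> split_ifs <;> omega

/-- Every monomial is a basis representative times powers of `x_{e-1}` and `y`, up to `barMap`. -/
lemma exists_decomposition {e m n : ℕ} (he : 10 ≤ e) (hmn : m < n) (hn : n ≤ e - 2)
    (c : Option (SallyIdx e m n) →₀ ℕ) :
    ∃ r k l : ℕ, r < 2 * e - 1 ∧
      Finsupp.weight (expFst e m n) c = r + (xShift e m n r + k) * (2 * e - 1) ∧
      c.degree = aperyDegree e m n r + k + l := by
  have step : ∀ (c : Option (SallyIdx e m n) →₀ ℕ) (i : Option (SallyIdx e m n)),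
      (∃ r k l : ℕ, r < 2 * e - 1 ∧
        Finsupp.weight (expFst e m n) c = r + (xShift e m n r + k) * (2 * e - 1) ∧
        c.degree = aperyDegree e m n r + k + l) →
      ∃ r k l : ℕ, r < 2 * e - 1 ∧
        Finsupp.weight (expFst e m n) (Finsupp.single i 1 + c) =
          r + (xShift e m n r + k) * (2 * e - 1) ∧
        (Finsupp.single i 1 + c).degree = aperyDegree e m n r + k + l := by
    rintro c i ⟨r, k, l, hr, hw, hd⟩
    rcases i with _ | ⟨i, hi⟩
    · refine ⟨r, k, l + 1, hr, ?_, ?_⟩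
      · simp [Finsupp.weight_single, expFst, hw]
      · simp [Finsupp.degree_single, hd]; ring
    · by_cases h : r + (e + i) < 2 * e - 1
      · obtain ⟨h1, h2⟩ := shift_le_of_lt he hmn hi h
        obtain ⟨u, hu⟩ := Nat.exists_eq_add_of_le h1
        obtain ⟨v, hv⟩ := Nat.exists_eq_add_of_le h2
        refine ⟨r + (e + i), k + u, l + v, h, ?_, ?_⟩
        · simp only [map_add, Finsupp.weight_single, expFst, hw, hu, smul_eq_mul]; ring
        · simp only [map_add, Finsupp.degree_single, hd, aperyDegree]; omega
      · obtain ⟨s, hs⟩ := Nat.exists_eq_add_of_le (not_lt.mp h)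
        rw [add_comm (2 * e - 1)] at hs
        obtain ⟨h1, h2⟩ := shift_le_of_ge he hmn hn hi hr hs
        obtain ⟨u, hu⟩ := Nat.exists_eq_add_of_le h1
        obtain ⟨v, hv⟩ := Nat.exists_eq_add_of_le h2
        refine ⟨s, k + u, l + v, by omega, ?_, ?_⟩
        · simp only [map_add, Finsupp.weight_single, expFst, hw, smul_eq_mul]
          have : (xShift e m n s + (k + u)) * (2 * e - 1) =
            (xShift e m n r + k) * (2 * e - 1) + (2 * e - 1) := by
            rw [← add_one_mul]; congr 1; omega
          omega
        · simp only [map_add, Finsupp.degree_single, hd, aperyDegree]; omega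
  have mult : ∀ (k : ℕ) (i : Option (SallyIdx e m n)) (c : Option (SallyIdx e m n) →₀ ℕ),
      (∃ r k l : ℕ, r < 2 * e - 1 ∧
        Finsupp.weight (expFst e m n) c = r + (xShift e m n r + k) * (2 * e - 1) ∧
        c.degree = aperyDegree e m n r + k + l) →
      ∃ r j l : ℕ, r < 2 * e - 1 ∧
        Finsupp.weight (expFst e m n) (Finsupp.single i k + c) =
          r + (xShift e m n r + j) * (2 * e - 1) ∧
        (Finsupp.single i k + c).degree = aperyDegree e m n r + j + l := by
    intro k i c hc
    induction k with
    | zero => simpa using hc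
    | succ k ih =>
      have := step _ i ih
      rwa [← add_assoc, ← Finsupp.single_add, add_comm 1 k] at this
  induction c using Finsupp.induction with
  | zero => exact ⟨0, 0, 0, by omega, by simp [xShift], by simp [aperyDegree, xShift, yShift]⟩
  | single_add i k c _ _ ih => exact mult k i c ih

lemma exists_pair_of_lt {e m n r : ℕ} (hm : 1 ≤ m) (hmn : m < n) (hr0 : 0 < r) (hr : r < e)
    (hgap : ¬ ((r = 2 ∧ m = 1) ∨ (r = 3 ∧ m = 1 ∧ n = 2) ∨ (r = 4 ∧ n = 3 ∧ (m = 1 ∨ m = 2)))) :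
    ∃ i j, (i < e ∧ i ≠ m ∧ i ≠ n) ∧ (j < e ∧ j ≠ m ∧ j ≠ n) ∧ i + j + 1 = r := by
  by_cases h0 : r - 1 ≠ m ∧ r - 1 ≠ n
  · exact ⟨0, r - 1, by omega, by omega, by omega⟩
  by_cases h1 : 2 ≤ r ∧ m ≠ 1 ∧ n ≠ 1 ∧ r - 2 ≠ m ∧ r - 2 ≠ n
  · exact ⟨1, r - 2, by omega, by omega, by omega⟩
  · exact ⟨2, r - 3, by omega, by omega, by omega⟩

lemma exists_pair_of_ge {e m n r : ℕ} (he : 10 ≤ e) (hmn : m < n)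
    (hn : n ≤ e - 2) (hmn' : ¬ (m = e - 4 ∧ n = e - 3)) (hr : r = e + m ∨ r = e + n)
    (hgap : ¬ (n = e - 2 ∧ (r = 2 * e - 2 ∨ (r = 2 * e - 3 ∧ m = e - 3) ∨
      (r = 2 * e - 4 ∧ m = e - 4)))) :
    ∃ i j, (i < e ∧ i ≠ m ∧ i ≠ n) ∧ (j < e ∧ j ≠ m ∧ j ≠ n) ∧ i + j + 1 = r := by
  rcases hr with rfl | rfl
  · by_cases h : n = e - 2 ∨ n = m + 1
    · exact ⟨e - 3, m + 2, by omega, by omega, by omega⟩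
    · exact ⟨e - 2, m + 1, by omega, by omega, by omega⟩
  · exact ⟨e - 2, n + 1, by omega, by omega, by omega⟩

lemma exists_weight_one {e m n i : ℕ} (hi : i < e ∧ i ≠ m ∧ i ≠ n) :
    ∃ c : Option (SallyIdx e m n) →₀ ℕ,
      Finsupp.weight (expFst e m n) c = e + i ∧ c.degree = 1 :=
  ⟨Finsupp.single (some ⟨i, hi⟩) 1, by simp [Finsupp.weight_single, expFst],
    by simp [Finsupp.degree_single]⟩

lemma exists_weight_two {e m n i j : ℕ} (hi : i < e ∧ i ≠ m ∧ i ≠ n)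
    (hj : j < e ∧ j ≠ m ∧ j ≠ n) :
    ∃ c : Option (SallyIdx e m n) →₀ ℕ,
      Finsupp.weight (expFst e m n) c = 2 * e + i + j ∧ c.degree = 2 := by
  obtain ⟨c, hc, hc'⟩ := exists_weight_one hi
  obtain ⟨c₂, hc₂, hc₂'⟩ := exists_weight_one hj
  exact ⟨c + c₂, by rw [map_add, hc, hc₂]; ring, by rw [map_add, hc', hc₂']⟩

lemma exists_weight_three {e m n j k : ℕ} (h0 : 0 < e ∧ 0 ≠ m ∧ 0 ≠ n)
    (hj : j < e ∧ j ≠ m ∧ j ≠ n) (hk : k < e ∧ k ≠ m ∧ k ≠ n) :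
    ∃ c : Option (SallyIdx e m n) →₀ ℕ,
      Finsupp.weight (expFst e m n) c = 3 * e + j + k ∧ c.degree = 3 := by
  obtain ⟨c, hc, hc'⟩ := exists_weight_one h0
  obtain ⟨c₂, hc₂, hc₂'⟩ := exists_weight_two hj hk
  exact ⟨c + c₂, by rw [map_add, hc, hc₂]; ring, by rw [map_add, hc', hc₂']⟩

lemma exists_representative_of_lt {e m n r : ℕ} (he : 10 ≤ e) (hm : 1 ≤ m) (hmn : m < n)
    (hr0 : 0 < r) (hr : r < e) :
    ∃ c : Option (SallyIdx e m n) →₀ ℕ,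
      Finsupp.weight (expFst e m n) c = r + xShift e m n r * (2 * e - 1) ∧
      c.degree = aperyDegree e m n r := by
  unfold aperyDegree
  have hy : yShift e m n r = 1 := by unfold yShift; rw [if_neg (by omega), if_neg (by omega)]
  by_cases hgap : (r = 2 ∧ m = 1) ∨ (r = 3 ∧ m = 1 ∧ n = 2) ∨ (r = 4 ∧ n = 3 ∧ (m = 1 ∨ m = 2))
  · have hx : xShift e m n r = 2 := by
      unfold xShift; rw [if_neg (by omega), if_neg (by omega), if_pos hgap]
    rw [hx, hy]
    by_cases hn4 : n = 4 ∨ n = e - 4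
    · obtain ⟨c, hc, hc'⟩ := exists_weight_three (e := e) (m := m) (n := n) (j := r + 1)
        (k := e - 3) (by omega) (by omega) (by omega)
      exact ⟨c, by omega, hc'⟩
    · obtain ⟨c, hc, hc'⟩ := exists_weight_three (e := e) (m := m) (n := n) (j := r + 2)
        (k := e - 4) (by omega) (by omega) (by omega)
      exact ⟨c, by omega, hc'⟩
  · have hx : xShift e m n r = 1 := by
      unfold xShift; rw [if_neg (by omega), if_neg (by omega), if_neg hgap]
    rw [hx, hy]
    obtain ⟨i, j, hi, hj, hij⟩ := exists_pair_of_lt hm hmn hr0 hr hgap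
    obtain ⟨c, hc, hc'⟩ := exists_weight_two hi hj
    exact ⟨c, by omega, hc'⟩

lemma exists_representative_of_ge {e m n r : ℕ} (he : 10 ≤ e) (hm : 1 ≤ m) (hmn : m < n)
    (hn : n ≤ e - 2) (hmn' : ¬ (m = e - 4 ∧ n = e - 3)) (her : e ≤ r) (hr : r < 2 * e - 1) :
    ∃ c : Option (SallyIdx e m n) →₀ ℕ,
      Finsupp.weight (expFst e m n) c = r + xShift e m n r * (2 * e - 1) ∧
      c.degree = aperyDegree e m n r := by
  unfold aperyDegree
  by_cases hgen : r = e + m ∨ r = e + n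
  · have hx : xShift e m n r = 1 := by
      unfold xShift; rw [if_neg (by omega), if_pos her, if_pos hgen]
    by_cases hgap : n = e - 2 ∧ (r = 2 * e - 2 ∨ (r = 2 * e - 3 ∧ m = e - 3) ∨
        (r = 2 * e - 4 ∧ m = e - 4))
    · have hy : yShift e m n r = 2 := by unfold yShift; rw [if_neg (by omega), if_pos hgap]
      rw [hx, hy]
      by_cases h0 : r - e - 1 = m
      · obtain ⟨c, hc, hc'⟩ := exists_weight_three (e := e) (m := m) (n := n) (j := 1)
          (k := r - e - 2) (by omega) (by omega) (by omega)
        exact ⟨c, by omega, hc'⟩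
      · obtain ⟨c, hc, hc'⟩ := exists_weight_three (e := e) (m := m) (n := n) (j := 0)
          (k := r - e - 1) (by omega) (by omega) (by omega)
        exact ⟨c, by omega, hc'⟩
    · have hy : yShift e m n r = 1 := by unfold yShift; rw [if_neg (by omega), if_neg hgap]
      rw [hx, hy]
      obtain ⟨i, j, hi, hj, hij⟩ := exists_pair_of_ge he hmn hn hmn' hgen hgap
      obtain ⟨c, hc, hc'⟩ := exists_weight_two hi hj
      exact ⟨c, by omega, hc'⟩
  · have hx : xShift e m n r = 0 := by
      unfold xShift; rw [if_neg (by omega), if_pos her, if_neg hgen]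
    have hy : yShift e m n r = 1 := by unfold yShift; rw [if_neg (by omega), if_neg (by omega)]
    rw [hx, hy]
    obtain ⟨c, hc, hc'⟩ := exists_weight_one (e := e) (m := m) (n := n) (i := r - e) (by omega)
    exact ⟨c, by omega, hc'⟩

/-- Every basis representative is attained by a monomial. -/
lemma exists_representative {e m n r : ℕ} (he : 10 ≤ e) (hm : 1 ≤ m) (hmn : m < n)
    (hn : n ≤ e - 2) (hmn' : (m, n) ≠ (e - 4, e - 3)) (hr : r < 2 * e - 1) :
    ∃ c : Option (SallyIdx e m n) →₀ ℕ,
      Finsupp.weight (expFst e m n) c = r + xShift e m n r * (2 * e - 1) ∧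
      c.degree = aperyDegree e m n r := by
  rcases Nat.eq_zero_or_pos r with rfl | hr0
  · exact ⟨0, by simp [xShift], by simp [aperyDegree, xShift, yShift]⟩
  rcases lt_or_ge r e with her | her
  · exact exists_representative_of_lt he hm hmn hr0 her
  · exact exists_representative_of_ge he hm hmn hn (fun h => hmn' (by rw [h.1, h.2])) her hr

lemma barMap_monomial {e m n : ℕ} (c : Option (SallyIdx e m n) →₀ ℕ) (q : ℚ) :
    barMap e m n (monomial c q) =
      monomial (Finsupp.single 0 (Finsupp.weight (expFst e m n) c) +
        Finsupp.single 1 (Finsupp.weight (expSnd e m n) c)) q := by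
  rw [barMap, aeval_monomial, monomial_add_single, ← C_mul_X_pow_eq_monomial,
    Finsupp.weight_apply, Finsupp.weight_apply, Finsupp.sum, Finsupp.sum, mul_assoc,
    ← Finset.prod_pow_eq_pow_sum, ← Finset.prod_pow_eq_pow_sum, ← Finset.prod_mul_distrib]
  rw [algebraMap_eq, Finsupp.prod]
  congr 1
  refine Finset.prod_congr rfl fun i _ => ?_
  rcases i with _ | i <;> simp [expFst, expSnd, mul_pow, ← pow_mul, mul_comm]

lemma weight_expFst_add_expSnd {e m n : ℕ} (he : 1 ≤ e) (c : Option (SallyIdx e m n) →₀ ℕ) :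
    Finsupp.weight (expFst e m n) c + Finsupp.weight (expSnd e m n) c =
      c.degree * (2 * e - 1) := by
  rw [Finsupp.weight_apply, Finsupp.weight_apply, Finsupp.sum, Finsupp.sum, Finsupp.degree_apply,
    ← Finset.sum_add_distrib, Finset.sum_mul]
  refine Finset.sum_congr rfl fun i _ => ?_
  rcases i with _ | ⟨i, hi⟩
  · simp [expFst, expSnd]
  · rw [← smul_add, smul_eq_mul, expFst, expSnd]
    congr 1
    dsimp only
    omega

/-- Coordinates of a bivariate monomial in the basis of `A`: a monomial `t₁^a t₂^b` is sent to the basis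
vector of the residue class of `a` if it is the basis representative of that class, else to `0`. -/
noncomputable def residueVector (e m n : ℕ) (v : Fin 2 →₀ ℕ) : ℕ →₀ ℚ :=
  let r := v 0 % (2 * e - 1)
  if v 0 = r + xShift e m n r * (2 * e - 1) ∧ v 0 + v 1 = aperyDegree e m n r * (2 * e - 1) then
    Finsupp.single r 1
  else 0

/-- The linear map from `R(e,m,n)[y]` recording coordinates in the monomial basis of `A`. -/
noncomputable def coordMap (e m n : ℕ) :
    MvPolynomial (Option (SallyIdx e m n)) ℚ →ₗ[ℚ] (ℕ →₀ ℚ) :=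
  ((basisMonomials (Fin 2) ℚ).constr ℚ (residueVector e m n)) ∘ₗ (barMap e m n).toLinearMap

lemma coordMap_monomial {e m n : ℕ} (he : 1 ≤ e) (c : Option (SallyIdx e m n) →₀ ℕ)
    {r k l : ℕ} (hr : r < 2 * e - 1)
    (hw : Finsupp.weight (expFst e m n) c = r + (xShift e m n r + k) * (2 * e - 1))
    (hd : c.degree = aperyDegree e m n r + k + l) :
    coordMap e m n (monomial c 1) = if k = 0 ∧ l = 0 then Finsupp.single r 1 else 0 := by
  have hD : 0 < 2 * e - 1 := by omega
  have hmod : Finsupp.weight (expFst e m n) c % (2 * e - 1) = r := by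
    rw [hw, Nat.add_mul_mod_self_right, Nat.mod_eq_of_lt hr]
  have hcoord : coordMap e m n (monomial c 1) = residueVector e m n
      (Finsupp.single 0 (Finsupp.weight (expFst e m n) c) +
        Finsupp.single 1 (Finsupp.weight (expSnd e m n) c)) := by
    rw [coordMap, LinearMap.comp_apply, AlgHom.toLinearMap_apply, barMap_monomial]
    exact (basisMonomials (Fin 2) ℚ).constr_basis ℚ (residueVector e m n) _
  rw [hcoord, residueVector]
  simp only [Finsupp.add_apply, Finsupp.single_eq_same, ne_eq, one_ne_zero, zero_ne_one,
    not_false_eq_true, Finsupp.single_eq_of_ne, add_zero, zero_add, hmod,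
    weight_expFst_add_expSnd he, Nat.mul_left_inj hD.ne']
  refine if_congr ?_ rfl rfl
  rw [hw, hd, Nat.add_left_cancel_iff, Nat.mul_left_inj hD.ne']
  omega

lemma coordMap_eq_zero_of_barIdeal {e m n : ℕ} {f : MvPolynomial (Option (SallyIdx e m n)) ℚ}
    (hf : f ∈ barIdeal e m n) : coordMap e m n f = 0 := by
  have : barMap e m n f = 0 := hf
  rw [coordMap, LinearMap.comp_apply, AlgHom.toLinearMap_apply, this, map_zero]

lemma coordMap_mul_monomial_eq_zero {e m n : ℕ} (he : 10 ≤ e) (hmn : m < n) (hn : n ≤ e - 2)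
    {i : Option (SallyIdx e m n)} (hi : expFst e m n i = 0 ∨ expFst e m n i = 2 * e - 1)
    (f : MvPolynomial (Option (SallyIdx e m n)) ℚ) : coordMap e m n (f * X i) = 0 := by
  induction f using MvPolynomial.induction_on' with
  | add p q hp hq => rw [add_mul, map_add, hp, hq, add_zero]
  | monomial c q =>
    obtain ⟨r, k, l, hr, hw, hd⟩ := exists_decomposition he hmn hn c
    have : monomial c q * X i = q • monomial (c + Finsupp.single i 1) (1 : ℚ) := by
      rw [X, monomial_mul, smul_monomial, smul_eq_mul]
    rw [this, map_smul]
    rcases hi with hi | hi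
    · rw [coordMap_monomial (by omega) _ (k := k) (l := l + 1) hr
        (by simp [Finsupp.weight_single, hi, hw])
        (by simp [Finsupp.degree_single, hd]; ring), if_neg (by omega), smul_zero]
    · rw [coordMap_monomial (by omega) _ (k := k + 1) (l := l) hr
        (by simp [Finsupp.weight_single, hi, hw]; ring)
        (by simp [Finsupp.degree_single, hd]; ring), if_neg (by omega), smul_zero]

lemma bX_last {e m n : ℕ} (he : 10 ≤ e) (hmn : m < n) (hn : n ≤ e - 2) :
    bX e m n (e - 1) = X (some ⟨e - 1, by omega⟩) := dif_pos (by omega)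

lemma coordMap_eq_zero_of_artinIdeal {e m n : ℕ} (he : 10 ≤ e) (hmn : m < n) (hn : n ≤ e - 2)
    {f : MvPolynomial (Option (SallyIdx e m n)) ℚ}
    (hf : f ∈ artinIdeal e m n) : coordMap e m n f = 0 := by
  obtain ⟨g, hg, h, hh, rfl⟩ := Submodule.mem_sup.mp hf
  obtain ⟨a, b, rfl⟩ := Ideal.mem_span_pair.mp hh
  rw [bX_last he hmn hn, map_add, map_add, coordMap_eq_zero_of_barIdeal hg,
    coordMap_mul_monomial_eq_zero he hmn hn (Or.inl rfl),
    coordMap_mul_monomial_eq_zero he hmn hn (Or.inr (by simp only [expFst]; omega))]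
  simp

lemma mk_monomial_congr {e m n : ℕ} (he : 1 ≤ e) {c c' : Option (SallyIdx e m n) →₀ ℕ}
    (hw : Finsupp.weight (expFst e m n) c = Finsupp.weight (expFst e m n) c')
    (hd : c.degree = c'.degree) :
    Ideal.Quotient.mkₐ ℚ (artinIdeal e m n) (monomial c 1) =
      Ideal.Quotient.mkₐ ℚ (artinIdeal e m n) (monomial c' 1) := by
  have h := weight_expFst_add_expSnd he c
  have h' := weight_expFst_add_expSnd he c'
  refine Ideal.Quotient.eq.mpr (Ideal.mem_sup_left ?_)
  change barMap e m n (monomial c 1 - monomial c' 1) = 0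
  rw [map_sub, barMap_monomial, barMap_monomial, hw,
    show Finsupp.weight (expSnd e m n) c = Finsupp.weight (expSnd e m n) c' by
      rw [hd] at h; omega, sub_self]

lemma mk_monomial_add_single_eq_zero {e m n : ℕ} {c : Option (SallyIdx e m n) →₀ ℕ}
    {i : Option (SallyIdx e m n)} {k : ℕ} (hk : k ≠ 0)
    (hi : (X i : MvPolynomial (Option (SallyIdx e m n)) ℚ) = X none ∨
      (X i : MvPolynomial (Option (SallyIdx e m n)) ℚ) = bX e m n (e - 1)) :
    Ideal.Quotient.mkₐ ℚ (artinIdeal e m n) (monomial (c + Finsupp.single i k) 1) = 0 := by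
  refine Ideal.Quotient.eq_zero_iff_mem.mpr (Ideal.mem_sup_right ?_)
  rw [monomial_add_single]
  have hmem : X i ∈ ({X none, bX e m n (e - 1)} : Set (MvPolynomial (Option (SallyIdx e m n)) ℚ)) :=
    hi
  exact Ideal.mul_mem_left _ _ (Ideal.pow_mem_of_mem _ (Ideal.subset_span hmem) _
    (Nat.pos_of_ne_zero hk))

/-- The coordinate map has the same kernel as the projection to `A`: the projection can be
recovered from the coordinates. -/
lemma exists_comp_coordMap_eq_mk {e m n : ℕ} (he : 10 ≤ e) (hm : 1 ≤ m) (hmn : m < n)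
    (hn : n ≤ e - 2) (hmn' : (m, n) ≠ (e - 4, e - 3)) :
    ∃ ρ : (ℕ →₀ ℚ) →ₗ[ℚ] MvPolynomial (Option (SallyIdx e m n)) ℚ ⧸ artinIdeal e m n,
      ∀ f, ρ (coordMap e m n f) = Ideal.Quotient.mkₐ ℚ (artinIdeal e m n) f := by
  have hrep := fun r (hr : r < 2 * e - 1) => exists_representative he hm hmn hn hmn' hr
  choose! rep hrepw hrepd using hrep
  refine ⟨Finsupp.linearCombination ℚ
    fun r => Ideal.Quotient.mkₐ ℚ (artinIdeal e m n) (monomial (rep r) 1), fun f => ?_⟩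
  induction f using MvPolynomial.induction_on' with
  | add p q hp hq => rw [map_add, map_add, hp, hq, map_add]
  | monomial c q =>
    obtain ⟨r, k, l, hr, hw, hd⟩ := exists_decomposition he hmn hn c
    rw [show monomial c q = q • monomial c (1 : ℚ) by rw [smul_monomial, smul_eq_mul, mul_one],
      map_smul, map_smul, map_smul, coordMap_monomial (by omega) c hr hw hd]
    congr 1
    set last : Option (SallyIdx e m n) := some ⟨e - 1, by omega⟩
    have hlast : expFst e m n last = 2 * e - 1 := by simp only [last, expFst]; omega
    have hmk : Ideal.Quotient.mkₐ ℚ (artinIdeal e m n) (monomial c 1) =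
        Ideal.Quotient.mkₐ ℚ (artinIdeal e m n)
          (monomial (rep r + Finsupp.single last k + Finsupp.single none l) 1) := by
      refine mk_monomial_congr (by omega) ?_ ?_
      · simp only [map_add, Finsupp.weight_single, hrepw r hr, hlast, hw, smul_eq_mul]
        simp only [expFst]
        ring
      · simp only [map_add, Finsupp.degree_single, hrepd r hr, hd]
    rw [hmk]
    split_ifs with h
    · simp [h.1, h.2]
    · rw [map_zero, eq_comm]
      by_cases hl : l = 0
      · rw [hl, Finsupp.single_zero, add_zero]
        exact mk_monomial_add_single_eq_zero (by omega) (Or.inr (bX_last he hmn hn).symm)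
      · exact mk_monomial_add_single_eq_zero hl (Or.inl rfl)

/-- The dimension of the image in `A` of a monomial subspace cut out by a set of degrees. -/
lemma finrank_map_mk {e m n : ℕ} (he : 10 ≤ e) (hm : 1 ≤ m) (hmn : m < n) (hn : n ≤ e - 2)
    (hmn' : (m, n) ≠ (e - 4, e - 3)) (Δ : ℕ → Prop) [DecidablePred Δ]
    (W : Submodule ℚ (MvPolynomial (Option (SallyIdx e m n)) ℚ))
    (hW : ∀ c : Option (SallyIdx e m n) →₀ ℕ, Δ c.degree → monomial c 1 ∈ W)
    (hW' : ∀ f ∈ W, ∀ c ∈ f.support, Δ c.degree) :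
    Module.finrank ℚ (W.map (Ideal.Quotient.mkₐ ℚ (artinIdeal e m n)).toLinearMap) =
      ((Finset.range (2 * e - 1)).filter fun r => Δ (aperyDegree e m n r)).card ∧
    Module.Finite ℚ (W.map (Ideal.Quotient.mkₐ ℚ (artinIdeal e m n)).toLinearMap) := by
  set T := (Finset.range (2 * e - 1)).filter fun r => Δ (aperyDegree e m n r) with hT
  obtain ⟨ρ, hρ⟩ := exists_comp_coordMap_eq_mk he hm hmn hn hmn'
  have himage : W.map (coordMap e m n) = Finsupp.supported ℚ ℚ (T : Set ℕ) := by
    apply le_antisymm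
    · rintro _ ⟨f, hf, rfl⟩
      rw [f.as_sum, map_sum]
      refine Submodule.sum_mem _ fun c hc => ?_
      obtain ⟨r, k, l, hr, hw, hd⟩ := exists_decomposition he hmn hn c
      rw [show monomial c (coeff c f) = coeff c f • monomial c (1 : ℚ) by
        rw [smul_monomial, smul_eq_mul, mul_one], map_smul,
        coordMap_monomial (by omega) c hr hw hd]
      refine Submodule.smul_mem _ _ ?_
      split_ifs with h
      · refine Finsupp.single_mem_supported _ _ ?_
        have := hW' f hf c hc
        rw [hd, h.1, h.2] at this
        simpa [hT, hr] using this
      · exact zero_mem _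
    · rw [Finsupp.supported_eq_span_single, Submodule.span_le]
      rintro _ ⟨r, hr, rfl⟩
      obtain ⟨hr, hΔ⟩ : r < 2 * e - 1 ∧ Δ (aperyDegree e m n r) := by simpa [hT] using hr
      obtain ⟨c, hc, hd⟩ := exists_representative he hm hmn hn hmn' hr
      refine ⟨monomial c 1, hW c (by rwa [hd]), ?_⟩
      rw [coordMap_monomial (by omega) c (k := 0) (l := 0) hr hc hd, if_pos ⟨rfl, rfl⟩]
  have hmap : W.map (Ideal.Quotient.mkₐ ℚ (artinIdeal e m n)).toLinearMap =
      (Finsupp.supported ℚ ℚ (T : Set ℕ)).map ρ := by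
    rw [← himage, ← Submodule.map_comp]
    congr 1
    exact LinearMap.ext fun f => (hρ f).symm
  have hinj : Set.InjOn ρ (Finsupp.supported ℚ ℚ (T : Set ℕ) : Set (ℕ →₀ ℚ)) := by
    rw [← himage]
    rintro _ ⟨f, -, rfl⟩ _ ⟨g, -, rfl⟩ h
    rw [hρ, hρ] at h
    have := coordMap_eq_zero_of_artinIdeal he hmn hn (Ideal.Quotient.eq.mp h)
    rwa [map_sub, sub_eq_zero] at this
  let E : (Finsupp.supported ℚ ℚ (T : Set ℕ)) ≃ₗ[ℚ]
      (Finsupp.supported ℚ ℚ (T : Set ℕ)).map ρ :=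
    LinearEquiv.ofBijective (ρ.submoduleMap _)
      ⟨fun x y h => Subtype.ext (hinj x.2 y.2 (congrArg Subtype.val h)),
        ρ.submoduleMap_surjective _⟩
  rw [hmap]
  refine ⟨?_, Module.Finite.equiv ((Finsupp.supportedEquivFinsupp (T : Set ℕ)).symm ≪≫ₗ E)⟩
  rw [← E.finrank_eq, (Finsupp.supportedEquivFinsupp (T : Set ℕ)).finrank_eq,
    Module.finrank_finsupp_self]
  simp

lemma finrank_artinPiece {e m n : ℕ} (he : 10 ≤ e) (hm : 1 ≤ m) (hmn : m < n) (hn : n ≤ e - 2)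
    (hmn' : (m, n) ≠ (e - 4, e - 3)) (d : ℕ) :
    Module.finrank ℚ (artinPiece e m n d) =
      ((Finset.range (2 * e - 1)).filter fun r => aperyDegree e m n r = d).card ∧
    Module.Finite ℚ (artinPiece e m n d) := by
  refine finrank_map_mk he hm hmn hn hmn' (fun k => k = d) _
    (fun c hc => isHomogeneous_monomial _ hc) fun f hf c hc => ?_
  rw [Finsupp.degree_eq_weight_one]
  exact hf (mem_support_iff.mp hc)

lemma finrank_quotient_artinIdeal {e m n : ℕ} (he : 10 ≤ e) (hm : 1 ≤ m) (hmn : m < n)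
    (hn : n ≤ e - 2) (hmn' : (m, n) ≠ (e - 4, e - 3)) :
    Module.finrank ℚ (MvPolynomial (Option (SallyIdx e m n)) ℚ ⧸ artinIdeal e m n) =
      2 * e - 1 := by
  have h := (finrank_map_mk he hm hmn hn hmn' (fun _ => True) ⊤ (fun _ _ => trivial)
    fun _ _ _ _ => trivial).1
  have htop : (⊤ : Submodule ℚ (MvPolynomial (Option (SallyIdx e m n)) ℚ)).map
      (Ideal.Quotient.mkₐ ℚ (artinIdeal e m n)).toLinearMap = ⊤ := by
    rw [Submodule.map_top, LinearMap.range_eq_top]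
    exact Ideal.Quotient.mkₐ_surjective ℚ (artinIdeal e m n)
  rw [htop, finrank_top] at h
  simpa using h

lemma card_aperyDegree_eq_zero {e m n : ℕ} (he : 10 ≤ e) :
    ((Finset.range (2 * e - 1)).filter fun r => aperyDegree e m n r = 0).card = 1 := by
  rw [Finset.card_eq_one]
  refine ⟨0, Finset.ext fun r => ?_⟩
  simp only [Finset.mem_filter, Finset.mem_range, Finset.mem_singleton]
  have : aperyDegree e m n r = 0 ↔ r = 0 := by
    unfold aperyDegree xShift yShift
    split_ifs <;> simp [*]
  omega

lemma card_aperyDegree_eq_one {e m n : ℕ} (he : 10 ≤ e) (hmn : m < n) (hn : n ≤ e - 2) :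
    ((Finset.range (2 * e - 1)).filter fun r => aperyDegree e m n r = 1).card = e - 3 := by
  have : ((Finset.range (2 * e - 1)).filter fun r => aperyDegree e m n r = 1) =
      ((Finset.Ico e (2 * e - 1)).erase (e + m)).erase (e + n) := by
    ext r
    simp only [Finset.mem_filter, Finset.mem_range, Finset.mem_erase, Finset.mem_Ico]
    unfold aperyDegree xShift yShift
    split_ifs <;> omega
  rw [this, Finset.card_erase_of_mem, Finset.card_erase_of_mem, Nat.card_Ico]
  · omega
  · simp only [Finset.mem_Ico]; omega
  · simp only [Finset.mem_erase, Finset.mem_Ico]; omega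

lemma aperyDegree_le_three {e m n : ℕ} (he : 10 ≤ e) (r : ℕ) : aperyDegree e m n r ≤ 3 := by
  unfold aperyDegree xShift yShift
  split_ifs <;> omega

lemma sum_card_aperyDegree {e m n : ℕ} (he : 10 ≤ e) :
    ∑ d ∈ Finset.range 4,
      ((Finset.range (2 * e - 1)).filter fun r => aperyDegree e m n r = d).card = 2 * e - 1 := by
  rw [← Finset.card_eq_sum_card_fiberwise (f := aperyDegree e m n), Finset.card_range]
  intro r _
  have := aperyDegree_le_three (m := m) (n := n) he r
  simp only [Finset.coe_range, Set.mem_Iio]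
  omega

theorem stmt15 (e m n : ℕ) (he : 10 ≤ e) (hm : 1 ≤ m) (hmn : m < n) (hn : n ≤ e - 2)
    (hmn' : (m, n) ≠ (e - 4, e - 3)) :
    -- `A` is a finite-dimensional `ℚ`-algebra of dimension `2e−1`
    Module.Finite ℚ (MvPolynomial (Option (SallyIdx e m n)) ℚ ⧸ artinIdeal e m n) ∧
    Module.finrank ℚ (MvPolynomial (Option (SallyIdx e m n)) ℚ ⧸ artinIdeal e m n) = 2 * e - 1 ∧
    -- `dim_K A_0 = 1`, `dim_K A_1 = e−3`
    Module.finrank ℚ (artinPiece e m n 0) = 1 ∧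
    Module.finrank ℚ (artinPiece e m n 1) = e - 3 ∧
    -- `A_d = 0` for `d ≥ 4`
    (∀ d : ℕ, 4 ≤ d → artinPiece e m n d = ⊥) ∧
    -- hence `dim_K A_2 + dim_K A_3 = e+1`
    Module.finrank ℚ (artinPiece e m n 2) + Module.finrank ℚ (artinPiece e m n 3) = e + 1 ∧
    -- and the Hilbert function of `A` is not symmetric
    (∃ s : ℕ, (artinPiece e m n s ≠ ⊥ ∧ ∀ d : ℕ, s < d → artinPiece e m n d = ⊥) ∧
      ∃ i : ℕ, Module.finrank ℚ (artinPiece e m n i) ≠ Module.finrank ℚ (artinPiece e m n (s - i))) := by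
  have hpiece := finrank_artinPiece he hm hmn hn hmn'
  have hrank := finrank_quotient_artinIdeal he hm hmn hn hmn'
  have hbot : ∀ d, Module.finrank ℚ (artinPiece e m n d) = 0 → artinPiece e m n d = ⊥ := fun d h =>
    have := (hpiece d).2
    Submodule.finrank_eq_zero.mp h
  have h0 := (hpiece 0).1.trans (card_aperyDegree_eq_zero he)
  have h1 := (hpiece 1).1.trans (card_aperyDegree_eq_one he hmn hn)
  have h4 : ∀ d, 4 ≤ d → artinPiece e m n d = ⊥ := fun d hd => hbot d <| by
    rw [(hpiece d).1, Finset.card_eq_zero, Finset.filter_eq_empty_iff]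
    intro r _
    have := aperyDegree_le_three (m := m) (n := n) he r
    omega
  have hsum := sum_card_aperyDegree (m := m) (n := n) he
  simp only [Finset.sum_range_succ, Finset.sum_range_zero, ← (hpiece _).1, h0, h1] at hsum
  have hne : ∀ d, Module.finrank ℚ (artinPiece e m n d) ≠ 0 → artinPiece e m n d ≠ ⊥ :=
    fun d h hd => h (by rw [hd, finrank_bot])
  refine ⟨Module.finite_of_finrank_pos (by omega), hrank, h0, h1, h4, by omega, ?_⟩
  by_cases h3 : Module.finrank ℚ (artinPiece e m n 3) = 0
  · refine ⟨2, ⟨hne 2 (by omega), fun d hd => ?_⟩, 0, h0.trans_ne (by rw [Nat.sub_zero]; omega)⟩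
    obtain rfl | hd : d = 3 ∨ 4 ≤ d := by omega
    · exact hbot 3 h3
    · exact h4 d hd
  · refine ⟨3, ⟨hne 3 h3, fun d hd => h4 d hd⟩, ?_⟩
    by_cases h3' : Module.finrank ℚ (artinPiece e m n 3) = 1
    · exact ⟨1, h1.trans_ne (by change _ ≠ Module.finrank ℚ (artinPiece e m n 2); omega)⟩
    · exact ⟨0, h0.trans_ne (by rw [Nat.sub_zero]; omega)⟩
end
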